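/- arXiv:2505.04039 — 3 statements merged into one kernel-verified Lean document; each statement's English description precedes it below -/
import Mathlib

section
/- Let l ≥ 1 and let ζ ∈ ℂ be a primitive p^l-th root of unity. Then for every s ≥ l, the identity T_{s+1}(z,ζ)·T_l(z^p,ζ^p) = T_{l+1}(z,ζ)·T_s(z^p,ζ^p) holds in ℂ[z]; in other words, the ratio T_{s+1}(z,ζ)/T_s(z^p,ζ^p) is independent of s for s ≥ l, so the limit λ(z,ζ) of these ratios exists and is a rational function of z. -/
open MvPolynomial Finset

/-- Dimension vector of the framed `A_{n-1}` quiver: `v i = min(i, k, n - i)`. -/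
def dimv (k n i : ℕ) : ℕ := min i (min k (n - i))

/-- `c_s = (p^s - 1)·ω` where `ω = r₀/q₀` (an integer under the standing hypotheses). -/
def cExp (p r₀ q₀ s : ℕ) : ℕ := (p ^ s - 1) * r₀ / q₀

/-- `a_s = (p^s - 1)·(1 - ω)`. -/
def aExp (p r₀ q₀ s : ℕ) : ℕ := (p ^ s - 1) - cExp p r₀ q₀ s

/-- `b_s = (p^s - 1)·(1 - 2ω)/2`. -/
def bExp (p r₀ q₀ s : ℕ) : ℕ := (p ^ s - 1 - 2 * cExp p r₀ q₀ s) / 2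

/-- The coefficient ring `ℤ[z,q]`, with `z = X false` and `q = X true`. -/
abbrev Zq : Type := MvPolynomial Bool ℤ

noncomputable def Zvar : Zq := MvPolynomial.X false
noncomputable def Qvar : Zq := MvPolynomial.X true

/-- The superpotential factor `Φ̄_s(x, z, q)`, a polynomial in the variables
`x_{i,j}` (indexed by pairs `(i,j) : ℕ × ℕ`) with coefficients in `ℤ[z,q]`. -/
noncomputable def Phibar (p r₀ q₀ k n s : ℕ) : MvPolynomial (ℕ × ℕ) Zq :=
  (∏ m ∈ Icc 1 (n - 1), ∏ j ∈ Icc 1 (dimv k n m), X (m, j)) ^ aExp p r₀ q₀ s *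
  (∏ m ∈ Icc 1 (n - 1),
    ∏ ij ∈ ((Icc 1 (dimv k n m)) ×ˢ (Icc 1 (dimv k n m))).filter (fun ij => ij.1 ≠ ij.2),
      ∏ r ∈ range (bExp p r₀ q₀ s), (X (m, ij.1) - C (Qvar ^ r) * X (m, ij.2))) *
  (∏ i ∈ Icc 1 (n - 2), ∏ a ∈ Icc 1 (dimv k n i), ∏ b ∈ Icc 1 (dimv k n (i + 1)),
      ∏ r ∈ range (cExp p r₀ q₀ s), (X (i, a) - C (Qvar ^ r) * X (i + 1, b))) *
  (∏ i ∈ Icc 1 k, ∏ r ∈ range (cExp p r₀ q₀ s),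
      (C Zvar - C (Qvar ^ r) * X (k, i)) * (1 - C (Qvar ^ r) * X (n - k, i)))

/-- The Vandermonde factor `Δ(x)`. -/
noncomputable def Vand (k n : ℕ) : MvPolynomial (ℕ × ℕ) Zq :=
  ∏ m ∈ Icc 1 (n - 1),
    ∏ ij ∈ ((Icc 1 (dimv k n m)) ×ˢ (Icc 1 (dimv k n m))).filter (fun ij => ij.1 < ij.2),
      (X (m, ij.2) - X (m, ij.1))

/-- `Φ_s = Δ · Φ̄_s`. -/
noncomputable def Phi (p r₀ q₀ k n s : ℕ) : MvPolynomial (ℕ × ℕ) Zq :=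
  Vand k n * Phibar p r₀ q₀ k n s

/-- Exponent vector of the monomial `∏_{i,j} x_{i,j}^{j·p^s - 1}`. -/
noncomputable def expVec (p k n s : ℕ) : (ℕ × ℕ) →₀ ℕ :=
  ∑ i ∈ Icc 1 (n - 1), ∑ j ∈ Icc 1 (dimv k n i), Finsupp.single (i, j) (j * p ^ s - 1)

/-- The truncation `T_s(z,q) ∈ ℤ[z,q]` of the K-theoretic vertex function of
`T*Gr(k,n)`: the coefficient of `∏ x_{i,j}^{j·p^s - 1}` in `Φ_s(x,z,q)`. -/
noncomputable def Ts (p r₀ q₀ k n s : ℕ) : Zq :=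
  MvPolynomial.coeff (expVec p k n s) (Phi p r₀ q₀ k n s)

/-- Evaluation `ℤ[z,q] → ℂ[z]` sending `q ↦ ζ` and `z ↦ z^e`. -/
noncomputable def evalQ (ζ : ℂ) (e : ℕ) : Zq →+* Polynomial ℂ :=
  MvPolynomial.eval₂Hom (Int.castRingHom (Polynomial ℂ))
    (fun b => bif b then Polynomial.C ζ else Polynomial.X ^ e)

section Factorization

variable {R : Type*} [CommRing R]

/-- The product `∏_{r < c} (x - q^r y)`. -/
def qProd (q x y : R) (c : ℕ) : R := ∏ r ∈ range c, (x - q ^ r * y)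

theorem map_qProd {S F : Type*} [CommRing S] [FunLike F R S] [RingHomClass F R S] (f : F)
    (q x y : R) (c : ℕ) : f (qProd q x y c) = qProd (f q) (f x) (f y) c := by
  simp [qProd, map_prod]

theorem qProd_one (x y : R) (c : ℕ) : qProd 1 x y c = (x - y) ^ c := by
  simp [qProd]

theorem IsPrimitiveRoot.qProd_eq [IsDomain R] {q : R} {P : ℕ} (hq : IsPrimitiveRoot q P)
    (hP : 0 < P) (x y : R) : qProd q x y P = x ^ P - y ^ P := by
  classical
  rw [hq.pow_sub_pow_eq_prod_sub_mul x y hP, qProd]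
  have hinj : Set.InjOn (fun r => q ^ r) (range P : Set ℕ) := by
    intro i hi j hj h
    exact hq.pow_inj (by simpa using hi) (by simpa using hj) h
  have himage : Polynomial.nthRootsFinset P (1 : R) = (range P).image (fun r => q ^ r) := by
    symm
    apply Finset.eq_of_subset_of_card_le
    · intro w hw
      obtain ⟨r, -, rfl⟩ := Finset.mem_image.1 hw
      rw [Polynomial.mem_nthRootsFinset hP, ← pow_mul, mul_comm, pow_mul, hq.pow_eq_one, one_pow]
    · rw [hq.card_nthRootsFinset, Finset.card_image_of_injOn hinj, card_range]
  rw [himage, Finset.prod_image hinj]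

theorem IsPrimitiveRoot.qProd_mul_add [IsDomain R] {q : R} {P : ℕ} (hq : IsPrimitiveRoot q P)
    (hP : 0 < P) (x y : R) (c d : ℕ) :
    qProd q x y (P * c + d) = qProd 1 (x ^ P) (y ^ P) c * qProd q x y d := by
  have hmul : qProd q x y (P * c) = (x ^ P - y ^ P) ^ c := by
    induction c with
    | zero => simp [qProd]
    | succ c ih =>
      rw [pow_succ, ← ih, ← hq.qProd_eq hP, mul_add, mul_one]
      simp only [qProd, prod_range_add, pow_add, pow_mul, hq.pow_eq_one, one_pow, one_mul]
  rw [qProd_one, ← hmul]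
  simp only [qProd, prod_range_add, pow_add, pow_mul, hq.pow_eq_one, one_pow, one_mul]

end Factorization

section Superpotential

variable {R : Type*} [CommRing R]

/-- The ordered pairs of distinct indices in row `m`. -/
abbrev offPairs (k n m : ℕ) : Finset (ℕ × ℕ) :=
  ((Icc 1 (dimv k n m)) ×ˢ (Icc 1 (dimv k n m))).filter (fun ij => ij.1 ≠ ij.2)

/-- The increasing pairs of indices in row `m`. -/
abbrev ltPairs (k n m : ℕ) : Finset (ℕ × ℕ) :=
  ((Icc 1 (dimv k n m)) ×ˢ (Icc 1 (dimv k n m))).filter (fun ij => ij.1 < ij.2)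

/-- The superpotential with arbitrary parameters `z`, `q` and arbitrary exponents. -/
noncomputable def superpot (k n : ℕ) (z q : R) (a b c : ℕ) : MvPolynomial (ℕ × ℕ) R :=
  (∏ m ∈ Icc 1 (n - 1), ∏ j ∈ Icc 1 (dimv k n m), X (m, j)) ^ a *
  (∏ m ∈ Icc 1 (n - 1), ∏ ij ∈ offPairs k n m, qProd (C q) (X (m, ij.1)) (X (m, ij.2)) b) *
  (∏ i ∈ Icc 1 (n - 2), ∏ x ∈ Icc 1 (dimv k n i), ∏ y ∈ Icc 1 (dimv k n (i + 1)),
    qProd (C q) (X (i, x)) (X (i + 1, y)) c) *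
  (∏ i ∈ Icc 1 k, qProd (C q) (C z) (X (k, i)) c * qProd (C q) 1 (X (n - k, i)) c)

/-- The product of the Vandermonde determinants of all rows. -/
noncomputable def rowVand (R : Type*) [CommRing R] (k n : ℕ) : MvPolynomial (ℕ × ℕ) R :=
  ∏ m ∈ Icc 1 (n - 1), ∏ ij ∈ ltPairs k n m, (X (m, ij.2) - X (m, ij.1))

theorem map_Phibar (f : Zq →+* R) (p r₀ q₀ k n s : ℕ) :
    MvPolynomial.map f (Phibar p r₀ q₀ k n s) = superpot k n (f Zvar) (f Qvar)
      (aExp p r₀ q₀ s) (bExp p r₀ q₀ s) (cExp p r₀ q₀ s) := by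
  simp only [Phibar, superpot, qProd, map_mul, map_prod, map_pow, map_sub, map_one, map_X, map_C,
    prod_mul_distrib]

theorem map_Vand (f : Zq →+* R) (k n : ℕ) : MvPolynomial.map f (Vand k n) = rowVand R k n := by
  simp only [Vand, rowVand, map_prod, map_sub, map_X]

theorem superpot_mul_add [IsDomain R] (k n : ℕ) (z q : R) {P : ℕ} (hq : IsPrimitiveRoot q P)
    (hP : 0 < P) (a b c a' b' c' : ℕ) :
    superpot k n z q (P * a + a') (P * b + b') (P * c + c') =
      expand P (superpot k n (z ^ P) 1 a b c) * superpot k n z q a' b' c' := by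
  have hq' : IsPrimitiveRoot (C q : MvPolynomial (ℕ × ℕ) R) P :=
    hq.map_of_injective (C_injective _ _)
  simp only [superpot, hq'.qProd_mul_add hP, map_mul, map_prod, map_pow, map_qProd, expand_X,
    expand_C, map_one, one_pow, prod_mul_distrib, pow_add, pow_mul, prod_pow]
  ring

end Superpotential

section Symmetry

variable {R : Type*} [CommRing R] {k n : ℕ}

/-- The permutations of the double indices which act inside each row. -/
def rowPerm (π : ℕ → Equiv.Perm ℕ) : Equiv.Perm (ℕ × ℕ) := Equiv.prodShear (Equiv.refl ℕ) π

@[simp]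
theorem rowPerm_apply (π : ℕ → Equiv.Perm ℕ) (x : ℕ × ℕ) : rowPerm π x = (x.1, π x.1 x.2) := rfl

/-- The family `π` preserves each row of indices. -/
def PreservesRows (k n : ℕ) (π : ℕ → Equiv.Perm ℕ) : Prop :=
  ∀ m j, j ∈ Icc 1 (dimv k n m) ↔ π m j ∈ Icc 1 (dimv k n m)

theorem prod_offPairs_perm {π : ℕ → Equiv.Perm ℕ} (hπ : PreservesRows k n π) {M : Type*}
    [CommMonoid M] (m : ℕ) (f : ℕ × ℕ → M) :
    ∏ ij ∈ offPairs k n m, f (π m ij.1, π m ij.2) = ∏ ij ∈ offPairs k n m, f ij := by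
  refine Finset.prod_equiv (Equiv.prodCongr (π m) (π m)) (fun ij => ?_) (fun ij _ => rfl)
  rw [mem_filter, mem_filter, mem_product, mem_product]
  simp only [Equiv.prodCongr_apply, Prod.map_fst, Prod.map_snd, ne_eq,
    EmbeddingLike.apply_eq_iff_eq, ← hπ m _]

theorem prod_row_perm {π : ℕ → Equiv.Perm ℕ} (hπ : PreservesRows k n π) {M : Type*}
    [CommMonoid M] (m : ℕ) (f : ℕ → M) :
    ∏ j ∈ Icc 1 (dimv k n m), f (π m j) = ∏ j ∈ Icc 1 (dimv k n m), f j :=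
  Finset.prod_equiv (π m) (hπ m) (fun _ _ => rfl)

theorem rename_superpot {π : ℕ → Equiv.Perm ℕ} (hπ : PreservesRows k n π)
    (hk : dimv k n k = k) (hnk : dimv k n (n - k) = k) (z q : R) (a b c : ℕ) :
    rename (rowPerm π) (superpot k n z q a b c) = superpot k n z q a b c := by
  have hrows : ∏ m ∈ Icc 1 (n - 1), ∏ j ∈ Icc 1 (dimv k n m),
      (X (m, π m j) : MvPolynomial (ℕ × ℕ) R) =
      ∏ m ∈ Icc 1 (n - 1), ∏ j ∈ Icc 1 (dimv k n m), X (m, j) :=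
    prod_congr rfl fun m _ => prod_row_perm hπ m fun j => X (m, j)
  have hpairs : ∏ m ∈ Icc 1 (n - 1), ∏ ij ∈ offPairs k n m,
      qProd (C q : MvPolynomial (ℕ × ℕ) R) (X (m, π m ij.1)) (X (m, π m ij.2)) b =
      ∏ m ∈ Icc 1 (n - 1), ∏ ij ∈ offPairs k n m, qProd (C q) (X (m, ij.1)) (X (m, ij.2)) b :=
    prod_congr rfl fun m _ => prod_offPairs_perm hπ m
      fun ij => qProd (C q) (X (m, ij.1)) (X (m, ij.2)) b
  have hneighbours : ∏ i ∈ Icc 1 (n - 2), ∏ x ∈ Icc 1 (dimv k n i),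
      ∏ y ∈ Icc 1 (dimv k n (i + 1)),
        qProd (C q : MvPolynomial (ℕ × ℕ) R) (X (i, π i x)) (X (i + 1, π (i + 1) y)) c =
      ∏ i ∈ Icc 1 (n - 2), ∏ x ∈ Icc 1 (dimv k n i), ∏ y ∈ Icc 1 (dimv k n (i + 1)),
        qProd (C q) (X (i, x)) (X (i + 1, y)) c := by
    refine prod_congr rfl fun i _ => ?_
    rw [← prod_row_perm hπ i fun x => ∏ y ∈ Icc 1 (dimv k n (i + 1)),
      qProd (C q : MvPolynomial (ℕ × ℕ) R) (X (i, x)) (X (i + 1, y)) c]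
    exact prod_congr rfl fun x _ => prod_row_perm hπ (i + 1)
      fun y => qProd (C q) (X (i, π i x)) (X (i + 1, y)) c
  have hframe : ∏ j ∈ Icc 1 k, qProd (C q : MvPolynomial (ℕ × ℕ) R) (C z) (X (k, π k j)) c =
      ∏ j ∈ Icc 1 k, qProd (C q) (C z) (X (k, j)) c := by
    have h := prod_row_perm hπ k
      fun j => qProd (C q : MvPolynomial (ℕ × ℕ) R) (C z) (X (k, j)) c
    rwa [hk] at h
  have hframe' : ∏ j ∈ Icc 1 k,
      qProd (C q : MvPolynomial (ℕ × ℕ) R) 1 (X (n - k, π (n - k) j)) c =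
      ∏ j ∈ Icc 1 k, qProd (C q) 1 (X (n - k, j)) c := by
    have h := prod_row_perm hπ (n - k)
      fun j => qProd (C q : MvPolynomial (ℕ × ℕ) R) 1 (X (n - k, j)) c
    rwa [hnk] at h
  simp only [superpot, map_mul, map_pow, map_prod, map_qProd, rename_X, rename_C, map_one,
    rowPerm_apply, prod_mul_distrib]
  rw [hrows, hpairs, hneighbours, hframe, hframe']

theorem prod_offPairs_eq (m : ℕ) :
    ∏ ij ∈ offPairs k n m, (X (m, ij.2) - X (m, ij.1) : MvPolynomial (ℕ × ℕ) R) =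
      (-1) ^ #(ltPairs k n m) * (∏ ij ∈ ltPairs k n m, (X (m, ij.2) - X (m, ij.1))) ^ 2 := by
  have hsplit : offPairs k n m =
      ltPairs k n m ∪ (ltPairs k n m).map (Equiv.prodComm ℕ ℕ).toEmbedding := by
    ext ⟨i, j⟩
    simp only [offPairs, ltPairs, mem_filter, mem_product, mem_union, mem_map_equiv, mem_Icc,
      Equiv.prodComm_symm, Equiv.prodComm_apply, Prod.swap]
    omega
  have hdisj : Disjoint (ltPairs k n m) ((ltPairs k n m).map (Equiv.prodComm ℕ ℕ).toEmbedding) := by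
    rw [Finset.disjoint_left]
    rintro ⟨i, j⟩ h
    simp only [ltPairs, mem_filter, mem_product, mem_map_equiv, mem_Icc,
      Equiv.prodComm_symm, Equiv.prodComm_apply, Prod.swap] at h ⊢
    omega
  rw [hsplit, prod_union hdisj, prod_map]
  have hneg : ∀ ij ∈ ltPairs k n m, (X (m, ij.1) - X (m, ij.2) : MvPolynomial (ℕ × ℕ) R) =
      -1 * (X (m, ij.2) - X (m, ij.1)) := fun _ _ => by ring
  simp only [Equiv.coe_toEmbedding, Equiv.prodComm_apply, Prod.fst_swap, Prod.snd_swap]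
  rw [prod_congr rfl hneg, prod_mul_distrib, prod_const]
  ring

theorem rename_rowVand_eq_or_eq_neg [IsDomain R] {π : ℕ → Equiv.Perm ℕ}
    (hπ : PreservesRows k n π) :
    rename (rowPerm π) (rowVand R k n) = rowVand R k n ∨
      rename (rowPerm π) (rowVand R k n) = -rowVand R k n := by
  rw [← sq_eq_sq_iff_eq_or_eq_neg, rowVand]
  simp only [map_prod, ← prod_pow _ 2]
  refine prod_congr rfl fun m _ => ?_
  have h := congrArg (rename (rowPerm π)) (prod_offPairs_eq (R := R) (k := k) (n := n) m)
  simp only [map_mul, map_prod, map_pow, map_neg, map_one, map_sub, rename_X, rowPerm_apply] at h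
  rw [prod_offPairs_perm hπ m
    fun ij => (X (m, ij.2) - X (m, ij.1) : MvPolynomial (ℕ × ℕ) R), prod_offPairs_eq] at h
  have hunit : IsUnit ((-1 : MvPolynomial (ℕ × ℕ) R) ^ #(ltPairs k n m)) := isUnit_one.neg.pow _
  simpa only [map_sub, rename_X, rowPerm_apply, prod_pow] using (hunit.mul_left_cancel h).symm

end Symmetry
section Transposition

variable {R : Type*} [CommRing R] {k n : ℕ}

theorem Icc_dimv_subset {i j : ℕ} (h : j ∈ Icc 1 (dimv k n i)) : i ∈ Icc 1 (n - 1) := by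
  simp only [dimv, mem_Icc] at h ⊢
  omega

theorem rename_rowVand_of_swap_of_lt [IsDomain R] [CharZero R] {m a b : ℕ}
    (ha : a ∈ Icc 1 (dimv k n m)) (hb : b ∈ Icc 1 (dimv k n m)) (hab : a < b)
    {π : ℕ → Equiv.Perm ℕ} (hπ : rowPerm π = Equiv.swap (m, a) (m, b))
    (hrows : PreservesRows k n π) :
    rename (rowPerm π) (rowVand R k n) = -rowVand R k n := by
  classical
  refine (rename_rowVand_eq_or_eq_neg hrows).resolve_left fun hfix => ?_
  let K : Finset (Σ _ : ℕ, ℕ × ℕ) := (Icc 1 (n - 1)).sigma (ltPairs k n)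
  let f : (Σ _ : ℕ, ℕ × ℕ) → MvPolynomial (ℕ × ℕ) R :=
    fun t => X (t.1, t.2.2) - X (t.1, t.2.1)
  have hmem : (⟨m, a, b⟩ : Σ _ : ℕ, ℕ × ℕ) ∈ K := by
    simp only [K, ltPairs, mem_sigma, mem_filter, mem_product]
    exact ⟨Icc_dimv_subset ha, ⟨ha, hb⟩, hab⟩
  set D := ∏ t ∈ K.erase ⟨m, a, b⟩, f t with hD
  have hfactor : rowVand R k n = (X (m, b) - X (m, a)) * D := by
    rw [rowVand, prod_sigma', ← mul_prod_erase K f hmem]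
  have hne : (X (m, b) - X (m, a) : MvPolynomial (ℕ × ℕ) R) ≠ 0 := by
    rw [sub_ne_zero]
    intro h
    have := X_injective h
    simp only [Prod.mk.injEq, true_and] at this
    omega
  have hodd : rename (rowPerm π) D = -D := by
    rw [hfactor, map_mul, map_sub, rename_X, rename_X, hπ, Equiv.swap_apply_left,
      Equiv.swap_apply_right, ← hπ] at hfix
    apply mul_left_cancel₀ hne
    linear_combination -hfix
  let g : ℕ × ℕ → ℕ × ℕ := Function.update id (m, a) (m, b)
  have hg : g ∘ rowPerm π = g := by
    funext x
    simp only [hπ, g, Function.comp_apply, Function.update_apply, id, Equiv.swap_apply_def]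
    split_ifs <;> simp_all
  have hzero : rename g D = 0 := by
    have h := congrArg (rename g) hodd
    rw [rename_rename, hg, map_neg] at h
    exact self_eq_neg.1 h
  rw [hD, map_prod, prod_eq_zero_iff] at hzero
  obtain ⟨⟨m', a', b'⟩, ht, h0⟩ := hzero
  simp only [f, map_sub, rename_X, sub_eq_zero] at h0
  have h1 := X_injective h0
  simp only [K, ltPairs, mem_erase, mem_sigma, mem_filter, ne_eq, Sigma.mk.injEq, heq_eq_eq,
    Prod.mk.injEq, not_and] at ht
  simp only [g, Function.update_apply, id, Prod.mk.injEq] at h1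
  obtain ⟨ht, -, -, hlt⟩ := ht
  split_ifs at h1 with h2 h3 h3 <;> simp only [Prod.mk.injEq] at h1 <;> grind

theorem exists_rowPerm_eq_swap {m a b : ℕ} (ha : a ∈ Icc 1 (dimv k n m))
    (hb : b ∈ Icc 1 (dimv k n m)) :
    ∃ π, PreservesRows k n π ∧ rowPerm π = Equiv.swap (m, a) (m, b) := by
  classical
  refine ⟨Function.update 1 m (Equiv.swap a b), fun m' j => ?_, ?_⟩
  · rcases eq_or_ne m' m with rfl | hm
    · rw [Function.update_self, Equiv.swap_apply_def]
      split_ifs with h1 h2 <;> simp_all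
    · simp [Function.update_of_ne hm]
  · ext1 ⟨m', j⟩
    rw [rowPerm_apply]
    rcases eq_or_ne m' m with rfl | hm
    · simp only [Function.update_self, Equiv.swap_apply_def, Prod.mk.injEq, true_and]
      split_ifs <;> rfl
    · simp [Equiv.swap_apply_def, hm]

theorem exists_rename_rowVand_swap [IsDomain R] [CharZero R] {m a b : ℕ}
    (ha : a ∈ Icc 1 (dimv k n m)) (hb : b ∈ Icc 1 (dimv k n m)) (hab : a ≠ b) :
    ∃ π, PreservesRows k n π ∧ rowPerm π = Equiv.swap (m, a) (m, b) ∧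
      rename (rowPerm π) (rowVand R k n) = -rowVand R k n := by
  obtain ⟨π, hrows, hπ⟩ := exists_rowPerm_eq_swap ha hb
  refine ⟨π, hrows, hπ, ?_⟩
  rcases hab.lt_or_gt with h | h
  · exact rename_rowVand_of_swap_of_lt ha hb h hπ hrows
  · exact rename_rowVand_of_swap_of_lt hb ha h (hπ.trans (Equiv.swap_comm _ _)) hrows

theorem rowVand_ne_zero [IsDomain R] : rowVand R k n ≠ 0 := by
  simp only [rowVand, prod_ne_zero_iff]
  intro m _ ij hij
  rw [sub_ne_zero]
  intro h
  have h' := X_injective h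
  simp only [ltPairs, mem_filter] at hij
  simp only [Prod.mk.injEq, true_and] at h'
  omega

end Transposition

section Degrees

theorem sum_le_of_forall_ne {s : Finset ℕ} {f : ℕ → ℕ} (i : ℕ) (h : ∀ m, m ≠ i → f m = 0) :
    ∑ m ∈ s, f m ≤ f i := by
  by_cases hi : i ∈ s
  · exact (sum_eq_single_of_mem i hi fun m _ hm => h m hm).le
  · rw [sum_eq_zero]
    · exact Nat.zero_le _
    · exact fun m hm => h m fun hmi => hi (hmi ▸ hm)

theorem sum_ite_fst_le {s : Finset (ℕ × ℕ)} {t : Finset ℕ} {j : ℕ}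
    (h : ∀ ij ∈ s, ij.1 = j → ij.2 ∈ t) : ∑ ij ∈ s, (if j = ij.1 then 1 else 0) ≤ #t := by
  rw [← sum_filter, sum_const, smul_eq_mul, mul_one]
  refine card_le_card_of_injOn Prod.snd (fun ij hij => ?_) fun x hx y hy hxy => ?_
  · simp only [coe_filter, Set.mem_ofPred_eq] at hij
    exact h ij hij.1 hij.2.symm
  · simp only [coe_filter, Set.mem_ofPred_eq] at hx hy
    exact Prod.ext (hx.2.symm.trans hy.2) hxy

theorem sum_ite_snd_le {s : Finset (ℕ × ℕ)} {t : Finset ℕ} {j : ℕ}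
    (h : ∀ ij ∈ s, ij.2 = j → ij.1 ∈ t) : ∑ ij ∈ s, (if j = ij.2 then 1 else 0) ≤ #t := by
  rw [← sum_filter, sum_const, smul_eq_mul, mul_one]
  refine card_le_card_of_injOn Prod.fst (fun ij hij => ?_) fun x hx y hy hxy => ?_
  · simp only [coe_filter, Set.mem_ofPred_eq] at hij
    exact h ij hij.1 hij.2.symm
  · simp only [coe_filter, Set.mem_ofPred_eq] at hx hy
    exact Prod.ext hxy (hx.2.symm.trans hy.2)

variable {R : Type*} [CommRing R] {k n : ℕ}

theorem degreeOf_qProd_le {σ : Type*} (x : σ) (q : R) (f g : MvPolynomial σ R) (c : ℕ) :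
    degreeOf x (qProd (C q) f g c) ≤ c * (degreeOf x f + degreeOf x g) := by
  refine (degreeOf_prod_le _ _ _).trans ((sum_le_card_nsmul _ _
    (degreeOf x f + degreeOf x g) fun r _ => ?_).trans (by simp))
  refine (degreeOf_sub_le _ _ _).trans (max_le (Nat.le_add_right _ _) ?_)
  rw [← C_pow]
  exact (degreeOf_C_mul_le _ _ _).trans (Nat.le_add_left _ _)

theorem qProd_mem_supported {σ : Type*} {s : Set σ} {q : R} {f g : MvPolynomial σ R}
    (hf : f ∈ supported R s) (hg : g ∈ supported R s) (c : ℕ) :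
    qProd (C q) f g c ∈ supported R s :=
  prod_mem fun _ _ => sub_mem hf
    (mul_mem (pow_mem (Subalgebra.algebraMap_mem _ q) _) hg)

variable [IsDomain R]

theorem degreeOf_X_pair (i j m t : ℕ) :
    degreeOf (i, j) (X (m, t) : MvPolynomial (ℕ × ℕ) R) =
      if i = m then (if j = t then 1 else 0) else 0 := by
  rw [degreeOf_X]
  simp only [Prod.mk.injEq, ite_and]

theorem degreeOf_rowVand_lt {i j : ℕ} (hj : j ∈ Icc 1 (dimv k n i)) :
    degreeOf (i, j) (rowVand R k n) < dimv k n i := by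
  have hle : degreeOf (i, j) (rowVand R k n) ≤
      ∑ m ∈ Icc 1 (n - 1), ∑ ij ∈ ltPairs k n m, if i = m then
        ((if j = ij.2 then 1 else 0) + (if j = ij.1 then 1 else 0)) else 0 := by
    refine (degreeOf_prod_le _ _ _).trans (sum_le_sum fun m _ =>
      (degreeOf_prod_le _ _ _).trans (sum_le_sum fun ij _ => ?_))
    refine (degreeOf_sub_le _ _ _).trans ?_
    rw [degreeOf_X_pair, degreeOf_X_pair]
    split_ifs <;> simp
  refine hle.trans_lt ((sum_le_of_forall_ne i fun m hm => ?_).trans_lt ?_)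
  · simp [hm.symm]
  simp only [if_true, sum_add_distrib]
  have h1 : ∑ ij ∈ ltPairs k n i, (if j = ij.2 then 1 else 0) ≤ #(Icc 1 (j - 1)) :=
    sum_ite_snd_le fun ij hij h => by
      simp only [ltPairs, mem_filter, mem_product, mem_Icc] at hij ⊢
      omega
  have h2 : ∑ ij ∈ ltPairs k n i, (if j = ij.1 then 1 else 0) ≤ #(Icc (j + 1) (dimv k n i)) :=
    sum_ite_fst_le fun ij hij h => by
      simp only [ltPairs, mem_filter, mem_product, mem_Icc] at hij ⊢
      omega
  simp only [Nat.card_Icc, mem_Icc] at h1 h2 hj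
  omega

theorem dimv_neighbours_le (hk : 1 ≤ k) (hn : 2 * k ≤ n) {i : ℕ} (hi : i ∈ Icc 1 (n - 1)) :
    dimv k n (i + 1) + dimv k n (i - 1) + (if i = k then 1 else 0) +
      (if i = n - k then 1 else 0) ≤ 2 * dimv k n i := by
  simp only [dimv, mem_Icc] at hi ⊢
  split_ifs <;> omega

theorem degreeOf_superpot_le (hk : 1 ≤ k) (hn : 2 * k ≤ n) (z q : R) (a b c : ℕ) {i j : ℕ}
    (hj : j ∈ Icc 1 (dimv k n i)) :
    degreeOf (i, j) (superpot k n z q a b c) ≤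
      a + b * (2 * (dimv k n i - 1)) + c * (2 * dimv k n i) := by
  have hrows : degreeOf (i, j) ((∏ m ∈ Icc 1 (n - 1), ∏ t ∈ Icc 1 (dimv k n m),
      (X (m, t) : MvPolynomial (ℕ × ℕ) R)) ^ a) ≤ a := by
    refine (degreeOf_pow_le _ _ _).trans ((Nat.mul_le_mul_left a ?_).trans (mul_one a).le)
    refine (degreeOf_prod_le _ _ _).trans ((sum_le_sum fun m _ => degreeOf_prod_le _ _ _).trans ?_)
    simp only [degreeOf_X_pair]
    refine (sum_le_of_forall_ne i fun m hm => by simp [hm.symm]).trans ?_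
    simp only [if_true]
    refine (sum_le_of_forall_ne j fun m hm => by simp [hm.symm]).trans ?_
    simp
  have hpairs : degreeOf (i, j) (∏ m ∈ Icc 1 (n - 1), ∏ ij ∈ offPairs k n m,
      qProd (C q : MvPolynomial (ℕ × ℕ) R) (X (m, ij.1)) (X (m, ij.2)) b) ≤
      b * (2 * (dimv k n i - 1)) := by
    refine (degreeOf_prod_le _ _ _).trans ((sum_le_sum fun m _ => (degreeOf_prod_le _ _ _).trans
      (sum_le_sum fun ij _ => degreeOf_qProd_le _ _ _ _ _)).trans ?_)
    simp only [degreeOf_X_pair, ← mul_sum]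
    refine Nat.mul_le_mul_left b ?_
    refine (sum_le_of_forall_ne i fun m hm => by simp [hm.symm]).trans ?_
    simp only [if_true, sum_add_distrib]
    have hcard : #((Icc 1 (dimv k n i)).erase j) = dimv k n i - 1 := by
      rw [card_erase_of_mem hj, Nat.card_Icc, Nat.add_sub_cancel]
    have h1 : ∑ ij ∈ offPairs k n i, (if j = ij.1 then 1 else 0) ≤
        #((Icc 1 (dimv k n i)).erase j) :=
      sum_ite_fst_le fun ij hij h => by
        simp only [offPairs, mem_filter, mem_product, mem_Icc, mem_erase] at hij ⊢
        omega
    have h2 : ∑ ij ∈ offPairs k n i, (if j = ij.2 then 1 else 0) ≤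
        #((Icc 1 (dimv k n i)).erase j) :=
      sum_ite_snd_le fun ij hij h => by
        simp only [offPairs, mem_filter, mem_product, mem_Icc, mem_erase] at hij ⊢
        omega
    omega
  have hneighbours : degreeOf (i, j) (∏ m ∈ Icc 1 (n - 2), ∏ x ∈ Icc 1 (dimv k n m),
      ∏ y ∈ Icc 1 (dimv k n (m + 1)),
        qProd (C q : MvPolynomial (ℕ × ℕ) R) (X (m, x)) (X (m + 1, y)) c) ≤
      c * (dimv k n (i + 1) + dimv k n (i - 1)) := by
    refine (degreeOf_prod_le _ _ _).trans ((sum_le_sum fun m _ => (degreeOf_prod_le _ _ _).trans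
      (sum_le_sum fun x _ => (degreeOf_prod_le _ _ _).trans
      (sum_le_sum fun y _ => degreeOf_qProd_le _ _ _ _ _))).trans ?_)
    simp only [degreeOf_X_pair, ← mul_sum, sum_add_distrib]
    refine Nat.mul_le_mul_left c (Nat.add_le_add ?_ ?_)
    · refine (sum_le_of_forall_ne i fun m hm => by simp [hm.symm]).trans ?_
      simp only [if_true]
      refine (sum_le_of_forall_ne j fun m hm => by simp [hm.symm]).trans ?_
      simp
    · have hi : 1 ≤ i := (mem_Icc.1 (Icc_dimv_subset hj)).1
      refine (sum_le_of_forall_ne (i - 1) fun m hm => ?_).trans ?_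
      · have : i ≠ m + 1 := by omega
        simp [this]
      rw [Nat.sub_add_cancel hi]
      simp only [if_true]
      refine (sum_le_card_nsmul _ _ 1 fun x _ => ?_).trans (by simp)
      refine (sum_le_of_forall_ne j fun m hm => by simp [hm.symm]).trans ?_
      simp
  have hframe : degreeOf (i, j) (∏ t ∈ Icc 1 k,
      (qProd (C q : MvPolynomial (ℕ × ℕ) R) (C z) (X (k, t)) c *
        qProd (C q) 1 (X (n - k, t)) c)) ≤
      c * ((if i = k then 1 else 0) + (if i = n - k then 1 else 0)) := by
    refine (degreeOf_prod_le _ _ _).trans ((sum_le_sum fun t _ => (degreeOf_mul_le _ _ _).trans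
      (Nat.add_le_add (degreeOf_qProd_le _ _ _ _ _) (degreeOf_qProd_le _ _ _ _ _))).trans ?_)
    simp only [degreeOf_X_pair, degreeOf_C, degreeOf_one, zero_add, ← mul_add, ← mul_sum]
    refine Nat.mul_le_mul_left c ?_
    refine (sum_le_of_forall_ne j fun m hm => by simp [hm.symm]).trans ?_
    simp
  have hdim := Nat.mul_le_mul_left c (dimv_neighbours_le hk hn (Icc_dimv_subset hj))
  rw [superpot]
  refine (degreeOf_mul_le _ _ _).trans ((Nat.add_le_add ((degreeOf_mul_le _ _ _).trans
    (Nat.add_le_add ((degreeOf_mul_le _ _ _).trans (Nat.add_le_add hrows hpairs)) hneighbours))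
    hframe).trans ?_)
  linarith

/-- The set of double indices of the variables `x_{i,j}`. -/
abbrev indexSet (k n : ℕ) : Set (ℕ × ℕ) := {x | x.2 ∈ Icc 1 (dimv k n x.1)}

theorem X_mem_supported_indexSet {m j : ℕ} (h : j ∈ Icc 1 (dimv k n m)) :
    (X (m, j) : MvPolynomial (ℕ × ℕ) R) ∈ supported R (indexSet k n) :=
  X_mem_supported.2 h

theorem rowVand_mem_supported : rowVand R k n ∈ supported R (indexSet k n) := by
  refine prod_mem fun m _ => prod_mem fun ij hij => ?_
  have h := mem_product.1 (mem_filter.1 hij).1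
  exact sub_mem (X_mem_supported_indexSet h.2) (X_mem_supported_indexSet h.1)

theorem superpot_mem_supported (hk : dimv k n k = k) (hnk : dimv k n (n - k) = k) (z q : R)
    (a b c : ℕ) : superpot k n z q a b c ∈ supported R (indexSet k n) := by
  have hrows : ∏ m ∈ Icc 1 (n - 1), ∏ j ∈ Icc 1 (dimv k n m), (X (m, j)) ∈
      supported R (indexSet k n) :=
    prod_mem fun m _ => prod_mem fun j hj => X_mem_supported_indexSet hj
  have hpairs : ∏ m ∈ Icc 1 (n - 1), ∏ ij ∈ offPairs k n m,
      qProd (C q) (X (m, ij.1)) (X (m, ij.2)) b ∈ supported R (indexSet k n) := by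
    refine prod_mem fun m _ => prod_mem fun ij hij => ?_
    have h := mem_product.1 (mem_filter.1 hij).1
    exact qProd_mem_supported (X_mem_supported_indexSet h.1) (X_mem_supported_indexSet h.2) _
  have hneighbours : ∏ i ∈ Icc 1 (n - 2), ∏ x ∈ Icc 1 (dimv k n i),
      ∏ y ∈ Icc 1 (dimv k n (i + 1)), qProd (C q) (X (i, x)) (X (i + 1, y)) c ∈
      supported R (indexSet k n) :=
    prod_mem fun i _ => prod_mem fun x hx => prod_mem fun y hy =>
      qProd_mem_supported (X_mem_supported_indexSet hx) (X_mem_supported_indexSet hy) _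
  have hframe : ∏ i ∈ Icc 1 k, (qProd (C q) (C z) (X (k, i)) c *
      qProd (C q) 1 (X (n - k, i)) c) ∈ supported R (indexSet k n) := by
    refine prod_mem fun t ht => mul_mem (qProd_mem_supported ?_ ?_ _) (qProd_mem_supported ?_ ?_ _)
    · exact Subalgebra.algebraMap_mem (supported R (indexSet k n)) z
    · exact X_mem_supported_indexSet (hk.symm ▸ ht)
    · exact one_mem _
    · exact X_mem_supported_indexSet (hnk.symm ▸ ht)
  rw [superpot]
  exact mul_mem (mul_mem (mul_mem (pow_mem hrows a) hpairs) hneighbours) hframe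

end Degrees
section Coefficients

variable {k n : ℕ}

/-- The exponent vector with entry `f j` at every index `(i, j)` of a variable `x_{i,j}`. -/
noncomputable def rowExponent (k n : ℕ) (f : ℕ → ℕ) : (ℕ × ℕ) →₀ ℕ :=
  ∑ i ∈ Icc 1 (n - 1), ∑ j ∈ Icc 1 (dimv k n i), Finsupp.single (i, j) (f j)

theorem rowExponent_apply (f : ℕ → ℕ) (x : ℕ × ℕ) :
    rowExponent k n f x = if x.2 ∈ Icc 1 (dimv k n x.1) then f x.2 else 0 := by
  obtain ⟨i, j⟩ := x
  simp only [rowExponent, Finsupp.finsetSum_apply, Finsupp.single_apply, Prod.mk.injEq, ite_and]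
  have hinner (m : ℕ) : ∑ t ∈ Icc 1 (dimv k n m), (if m = i then if t = j then f t else 0 else 0) =
      if m = i then (if j ∈ Icc 1 (dimv k n m) then f j else 0) else 0 := by
    split_ifs <;> simp_all
  simp only [hinner, sum_ite_eq']
  by_cases hj : j ∈ Icc 1 (dimv k n i)
  · rw [if_pos (Icc_dimv_subset hj)]
  · simp [hj]

theorem mapDomain_rowPerm_apply (π : ℕ → Equiv.Perm ℕ) (u : (ℕ × ℕ) →₀ ℕ) (x : ℕ × ℕ) :
    u.mapDomain (rowPerm π) (rowPerm π x) = u x :=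
  Finsupp.mapDomain_apply (rowPerm π).injective u x

theorem mapDomain_rowExponent_const {π : ℕ → Equiv.Perm ℕ} (hπ : PreservesRows k n π) (N : ℕ) :
    (rowExponent k n fun _ => N).mapDomain (rowPerm π) = rowExponent k n fun _ => N := by
  ext y
  obtain ⟨x, rfl⟩ := (rowPerm π).surjective y
  rw [mapDomain_rowPerm_apply, rowExponent_apply, rowExponent_apply]
  simp only [rowPerm_apply, ← hπ x.1 x.2]

theorem exists_mapDomain_eq_rowExponent {u : (ℕ × ℕ) →₀ ℕ}
    (hinj : ∀ m, ∀ a ∈ Icc 1 (dimv k n m), ∀ b ∈ Icc 1 (dimv k n m), u (m, a) = u (m, b) → a = b)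
    (hlt : ∀ m, ∀ a ∈ Icc 1 (dimv k n m), u (m, a) < dimv k n m)
    (hzero : ∀ x ∉ indexSet k n, u x = 0) :
    ∃ π, PreservesRows k n π ∧ u.mapDomain (rowPerm π) = rowExponent k n fun j => j - 1 := by
  have hrow (m : ℕ) : ∃ σ : Equiv.Perm ℕ, (∀ j, j ∈ Icc 1 (dimv k n m) ↔
      σ j ∈ Icc 1 (dimv k n m)) ∧ ∀ j ∈ Icc 1 (dimv k n m), σ j = u (m, j) + 1 := by
    let g : {j // j ∈ Icc 1 (dimv k n m)} → {j // j ∈ Icc 1 (dimv k n m)} := fun j =>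
      ⟨u (m, j) + 1, mem_Icc.2 ⟨Nat.le_add_left _ _, hlt m j j.2⟩⟩
    have hg : Function.Injective g := fun a b hab =>
      Subtype.ext (hinj m a a.2 b b.2 (Nat.succ_injective (congrArg Subtype.val hab)))
    let e := Equiv.ofBijective g (Finite.injective_iff_bijective.1 hg)
    refine ⟨Equiv.Perm.ofSubtype e, fun j => ?_, fun j hj => ?_⟩
    · exact (Equiv.Perm.ofSubtype_apply_mem_iff_mem e j).symm
    · rw [Equiv.Perm.ofSubtype_apply_of_mem e hj]
      rfl
  choose π hπ hval using hrow
  refine ⟨π, hπ, ?_⟩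
  ext y
  obtain ⟨⟨m, j⟩, rfl⟩ := (rowPerm π).surjective y
  rw [mapDomain_rowPerm_apply, rowExponent_apply, rowPerm_apply]
  simp only [← hπ m j]
  split_ifs with hj
  · rw [hval m j hj, Nat.add_sub_cancel]
  · exact hzero _ hj

variable {R : Type*} [CommRing R]

theorem coeff_mapDomain_of_rename_eq {σ : Type*} {F G : MvPolynomial σ R} (τ : Equiv.Perm σ)
    (h : rename τ F = G) (u : σ →₀ ℕ) : coeff (u.mapDomain τ) G = coeff u F := by
  rw [← h, coeff_rename_mapDomain _ τ.injective]

theorem coeff_eq_zero_of_mem_supported {σ : Type*} {s : Set σ} {F : MvPolynomial σ R}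
    (hF : F ∈ supported R s) {u : σ →₀ ℕ} {x : σ} (hx : x ∉ s) (hu : u x ≠ 0) :
    coeff u F = 0 := by
  by_contra h
  refine hx (mem_supported.1 hF (mem_coe.2
    ((mem_vars_iff_mem_support x).2 ⟨u, mem_support_iff.2 h, ?_⟩)))
  exact Finsupp.mem_support_iff.2 hu

theorem coeff_eq_zero_of_degreeOf_lt {σ : Type*} {F : MvPolynomial σ R} {u : σ →₀ ℕ} {x : σ}
    (h : degreeOf x F < u x) : coeff u F = 0 := by
  by_contra h'
  exact absurd (monomial_le_degreeOf x (mem_support_iff.2 h')) (not_le.2 h)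

/-- The coefficients of an alternating polynomial `Δ·H` of small degree at the exponents congruent
to `-1` modulo `P` are proportional to those of the Vandermonde product `Δ`. -/
theorem coeff_alternating [IsDomain R] [CharZero R] {H : MvPolynomial (ℕ × ℕ) R} {P : ℕ}
    (hsymm : ∀ π, PreservesRows k n π → rename (rowPerm π) H = H)
    (hdeg : ∀ i j, j ∈ Icc 1 (dimv k n i) →
      degreeOf (i, j) (rowVand R k n * H) < dimv k n i * P + (P - 1))
    (hsupp : H ∈ supported R (indexSet k n)) (hP : 0 < P) (u : (ℕ × ℕ) →₀ ℕ) :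
    (coeff (P • u + rowExponent k n fun _ => P - 1) (rowVand R k n * H) = 0 ∧
      coeff u (rowVand R k n) = 0) ∨
    ∃ ε : R, coeff (P • u + rowExponent k n fun _ => P - 1) (rowVand R k n * H) =
        ε * coeff (P • (rowExponent k n fun j => j - 1) + rowExponent k n fun _ => P - 1)
          (rowVand R k n * H) ∧
      coeff u (rowVand R k n) = ε * coeff (rowExponent k n fun j => j - 1) (rowVand R k n) := by
  have hmap (π) (hπ : PreservesRows k n π) : (P • u + rowExponent k n fun _ => P - 1).mapDomain
      (rowPerm π) = P • u.mapDomain (rowPerm π) + rowExponent k n fun _ => P - 1 := by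
    rw [Finsupp.mapDomain_add, Finsupp.mapDomain_smul, mapDomain_rowExponent_const hπ]
  by_cases hinj : ∀ m, ∀ a ∈ Icc 1 (dimv k n m), ∀ b ∈ Icc 1 (dimv k n m),
    u (m, a) = u (m, b) → a = b
  swap
  · left
    push Not at hinj
    obtain ⟨m, a, ha, b, hb, hu, hab⟩ := hinj
    obtain ⟨π, hπ, hswap, hneg⟩ := exists_rename_rowVand_swap (R := R) ha hb hab
    have hfix : u.mapDomain (rowPerm π) = u := by
      ext y
      obtain ⟨x, rfl⟩ := (rowPerm π).surjective y
      rw [mapDomain_rowPerm_apply, hswap, Equiv.swap_apply_def]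
      split_ifs <;> simp_all
    have hneg' : rename (rowPerm π) (rowVand R k n * H) = -(rowVand R k n * H) := by
      rw [map_mul, hneg, hsymm π hπ, neg_mul]
    have h1 := coeff_mapDomain_of_rename_eq _ hneg' (P • u + rowExponent k n fun _ => P - 1)
    have h2 := coeff_mapDomain_of_rename_eq _ hneg u
    rw [hmap π hπ, hfix, coeff_neg] at h1
    rw [hfix, coeff_neg] at h2
    exact ⟨self_eq_neg.1 h1.symm, self_eq_neg.1 h2.symm⟩
  by_cases hlt : ∀ m, ∀ a ∈ Icc 1 (dimv k n m), u (m, a) < dimv k n m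
  swap
  · left
    push Not at hlt
    obtain ⟨m, a, ha, hu⟩ := hlt
    refine ⟨coeff_eq_zero_of_degreeOf_lt (x := (m, a)) ((hdeg m a ha).trans_le ?_),
      coeff_eq_zero_of_degreeOf_lt ((degreeOf_rowVand_lt ha).trans_le hu)⟩
    rw [Finsupp.add_apply, Finsupp.smul_apply, rowExponent_apply, if_pos ha, smul_eq_mul,
      mul_comm P]
    exact Nat.add_le_add_right (Nat.mul_le_mul_right P hu) _
  by_cases hzero : ∀ x ∉ indexSet k n, u x = 0
  swap
  · left
    push Not at hzero
    obtain ⟨x, hx, hu⟩ := hzero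
    refine ⟨coeff_eq_zero_of_mem_supported (mul_mem rowVand_mem_supported hsupp) hx ?_,
      coeff_eq_zero_of_mem_supported rowVand_mem_supported hx hu⟩
    rw [Finsupp.add_apply, Finsupp.smul_apply, smul_eq_mul]
    have := Nat.mul_pos hP (Nat.pos_of_ne_zero hu)
    omega
  right
  obtain ⟨π, hπ, hu⟩ := exists_mapDomain_eq_rowExponent hinj hlt hzero
  rcases rename_rowVand_eq_or_eq_neg (R := R) hπ with h | h
  · have h' : rename (rowPerm π) (rowVand R k n * H) = rowVand R k n * H := by
      rw [map_mul, h, hsymm π hπ]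
    refine ⟨1, ?_, ?_⟩
    · rw [← hu, ← hmap π hπ, coeff_mapDomain_of_rename_eq _ h', one_mul]
    · rw [← hu, coeff_mapDomain_of_rename_eq _ h, one_mul]
  · have h' : rename (rowPerm π) (rowVand R k n * H) = -(rowVand R k n * H) := by
      rw [map_mul, h, hsymm π hπ, neg_mul]
    refine ⟨-1, ?_, ?_⟩
    · rw [← coeff_mapDomain_of_rename_eq _ h', hmap π hπ, hu, coeff_neg, neg_one_mul]
    · rw [← coeff_mapDomain_of_rename_eq _ h, hu, coeff_neg, neg_one_mul]

theorem coeff_rowVand_ne_zero [IsDomain R] [CharZero R] :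
    coeff (rowExponent k n fun j => j - 1) (rowVand R k n) ≠ 0 := by
  intro h0
  refine rowVand_ne_zero (R := R) (k := k) (n := n) (MvPolynomial.ext _ _ fun u => ?_)
  rw [coeff_zero]
  rcases coeff_alternating (R := R) (k := k) (n := n) (H := 1) (P := 1)
    (fun π _ => map_one _) (fun i j hj => by simpa using degreeOf_rowVand_lt hj) (one_mem _)
    one_pos u with h | ⟨ε, -, h⟩
  · exact h.2
  · rw [h, h0, mul_zero]

/-- If the coefficients of `F` at the exponents `P • u + w` are proportional to those of `D` at `u`,
then the same holds for `expand P G * F` and `G * D`. -/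
theorem coeff_expand_mul {σ : Type*} {F D : MvPolynomial σ R} {P : ℕ} {w : σ →₀ ℕ} {t T : R}
    (hw : ∀ x, w x < P) (h : ∀ u, t * coeff (P • u + w) F = T * coeff u D)
    (G : MvPolynomial σ R) (u : σ →₀ ℕ) :
    t * coeff (P • u + w) (expand P G * F) = T * coeff u (G * D) := by
  induction G using MvPolynomial.induction_on' with
  | monomial d r =>
    have hle : P • d ≤ P • u + w ↔ d ≤ u := by
      simp only [Finsupp.le_def, Finsupp.add_apply, Finsupp.smul_apply, smul_eq_mul]
      refine forall_congr' fun x => ⟨fun hx => ?_, fun hx => ?_⟩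
      · have hP := (Nat.zero_le _).trans_lt (hw x)
        have : P * d x < P * (u x + 1) := by
          rw [mul_add, mul_one]
          exact hx.trans_lt (Nat.add_lt_add_left (hw x) _)
        exact Nat.lt_succ_iff.1 (Nat.lt_of_mul_lt_mul_left this)
      · exact (Nat.mul_le_mul_left P hx).trans (Nat.le_add_right _ _)
    rw [expand_monomial, coeff_monomial_mul', coeff_monomial_mul']
    by_cases hd : d ≤ u
    · rw [if_pos (hle.2 hd), if_pos hd]
      have hsub : P • u + w - P • d = P • (u - d) + w := by
        ext x
        have hx := Nat.mul_le_mul_left P (hd x)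
        simp only [Finsupp.add_apply, Finsupp.tsub_apply, Finsupp.smul_apply, smul_eq_mul,
          Nat.mul_sub]
        omega
      rw [hsub]
      linear_combination r * h (u - d)
    · rw [if_neg (mt hle.1 hd), if_neg hd, mul_zero, mul_zero]
  | add G₁ G₂ h₁ h₂ =>
    rw [map_add, add_mul, add_mul, coeff_add, coeff_add, mul_add, mul_add, h₁, h₂]

end Coefficients

section Exponents

variable {p r₀ q₀ : ℕ}

theorem cExp_mul (hcong : p ≡ 1 [MOD q₀]) (s : ℕ) : cExp p r₀ q₀ s * q₀ = (p ^ s - 1) * r₀ := by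
  refine Nat.div_mul_cancel (Dvd.dvd.mul_right ?_ r₀)
  have h : p ^ s ≡ 1 [MOD q₀] := by simpa using hcong.pow s
  rcases Nat.eq_zero_or_pos (p ^ s) with h0 | h0
  · simp [h0]
  · exact (Nat.modEq_iff_dvd' h0).1 h.symm

theorem pow_eq_bExp_cExp (hodd : Odd p) (hq₀ : 0 < q₀) (hω : 2 * r₀ ≤ q₀)
    (hcong : p ≡ 1 [MOD q₀]) (s : ℕ) :
    p ^ s = 2 * bExp p r₀ q₀ s + 2 * cExp p r₀ q₀ s + 1 := by
  have hle : 2 * cExp p r₀ q₀ s ≤ p ^ s - 1 := by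
    refine Nat.le_of_mul_le_mul_right ?_ hq₀
    calc 2 * cExp p r₀ q₀ s * q₀ = (p ^ s - 1) * (2 * r₀) := by
          rw [mul_assoc, cExp_mul hcong]; ring
      _ ≤ (p ^ s - 1) * q₀ := Nat.mul_le_mul_left _ hω
  obtain ⟨t, ht⟩ := hodd.pow (n := s)
  rw [bExp]
  omega

theorem aExp_eq (hodd : Odd p) (hq₀ : 0 < q₀) (hω : 2 * r₀ ≤ q₀) (hcong : p ≡ 1 [MOD q₀])
    (s : ℕ) : aExp p r₀ q₀ s = 2 * bExp p r₀ q₀ s + cExp p r₀ q₀ s := by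
  have h := pow_eq_bExp_cExp hodd hq₀ hω hcong s
  rw [aExp]
  omega

theorem cExp_add (hodd : Odd p) (hq₀ : 0 < q₀) (hω : 2 * r₀ ≤ q₀) (hcong : p ≡ 1 [MOD q₀])
    (l s : ℕ) : cExp p r₀ q₀ (l + s) = p ^ l * cExp p r₀ q₀ s + cExp p r₀ q₀ l := by
  apply Nat.eq_of_mul_eq_mul_right hq₀
  rw [add_mul, mul_assoc, cExp_mul hcong, cExp_mul hcong, cExp_mul hcong, pow_add]
  have h₁ := pow_eq_bExp_cExp hodd hq₀ hω hcong l
  have h₂ := pow_eq_bExp_cExp hodd hq₀ hω hcong s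
  obtain ⟨A, hA⟩ : ∃ A, p ^ l = A + 1 := ⟨_, h₁⟩
  obtain ⟨B, hB⟩ : ∃ B, p ^ s = B + 1 := ⟨_, h₂⟩
  have h : (A + 1) * (B + 1) - 1 = (A + 1) * B + A := by
    rw [mul_add, mul_one, ← add_assoc, Nat.add_sub_cancel]
  rw [hA, hB, Nat.add_sub_cancel, Nat.add_sub_cancel, h]
  ring

theorem bExp_add (hodd : Odd p) (hq₀ : 0 < q₀) (hω : 2 * r₀ ≤ q₀) (hcong : p ≡ 1 [MOD q₀])
    (l s : ℕ) : bExp p r₀ q₀ (l + s) = p ^ l * bExp p r₀ q₀ s + bExp p r₀ q₀ l := by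
  have h := pow_eq_bExp_cExp hodd hq₀ hω hcong (l + s)
  have hl := pow_eq_bExp_cExp hodd hq₀ hω hcong l
  have hs := congrArg (p ^ l * ·) (pow_eq_bExp_cExp hodd hq₀ hω hcong s)
  have hc := cExp_add hodd hq₀ hω hcong l s
  rw [pow_add] at h
  simp only [mul_add, mul_one, mul_left_comm _ 2] at hs
  linarith

theorem aExp_add (hodd : Odd p) (hq₀ : 0 < q₀) (hω : 2 * r₀ ≤ q₀) (hcong : p ≡ 1 [MOD q₀])
    (l s : ℕ) : aExp p r₀ q₀ (l + s) = p ^ l * aExp p r₀ q₀ s + aExp p r₀ q₀ l := by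
  simp only [aExp_eq hodd hq₀ hω hcong, bExp_add hodd hq₀ hω hcong, cExp_add hodd hq₀ hω hcong]
  ring

end Exponents

section Truncation

theorem evalQ_Zvar (ζ : ℂ) (e : ℕ) : evalQ ζ e Zvar = Polynomial.X ^ e := by
  simp [evalQ, Zvar]

theorem evalQ_Qvar (ζ : ℂ) (e : ℕ) : evalQ ζ e Qvar = Polynomial.C ζ := by
  simp [evalQ, Qvar]

theorem expVec_eq (p k n s : ℕ) : expVec p k n s = rowExponent k n fun j => j * p ^ s - 1 := rfl

theorem evalQ_Ts (ζ : ℂ) (e p r₀ q₀ k n s : ℕ) :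
    evalQ ζ e (Ts p r₀ q₀ k n s) = coeff (rowExponent k n fun j => j * p ^ s - 1)
      (rowVand (Polynomial ℂ) k n * superpot k n (Polynomial.X ^ e) (Polynomial.C ζ)
        (aExp p r₀ q₀ s) (bExp p r₀ q₀ s) (cExp p r₀ q₀ s)) := by
  rw [Ts, ← coeff_map, Phi, map_mul, map_Vand, map_Phibar, evalQ_Zvar, evalQ_Qvar, expVec_eq]

theorem rowExponent_mul_pow {p : ℕ} (hp : 0 < p) (k n l s : ℕ) :
    (rowExponent k n fun j => j * p ^ (l + s) - 1) =
      p ^ l • (rowExponent k n fun j => j * p ^ s - 1) + rowExponent k n fun _ => p ^ l - 1 := by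
  ext x
  simp only [Finsupp.add_apply, Finsupp.smul_apply, rowExponent_apply, smul_eq_mul]
  split_ifs with hx
  · have h : p ^ l ≤ p ^ l * (x.2 * p ^ s) :=
      Nat.le_mul_of_pos_right _ (Nat.mul_pos (mem_Icc.1 hx).1 (pow_pos hp s))
    have hl : 0 < p ^ l := pow_pos hp l
    rw [Nat.mul_sub, mul_one, pow_add, mul_left_comm]
    omega
  · rfl

/-- At a primitive `p^l`-th root of unity the truncation `T_{l+s}` factors, up to the constant
`T_0`, through `T_l` and the value of `T_s` at `q = 1`. -/
theorem evalQ_Ts_add {p r₀ q₀ k n : ℕ} (hodd : Odd p) (hq₀ : 0 < q₀) (hω : 2 * r₀ ≤ q₀)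
    (hcong : p ≡ 1 [MOD q₀]) (hk : 1 ≤ k) (hn : 2 * k ≤ n) {l : ℕ} {ζ : ℂ}
    (hζ : IsPrimitiveRoot ζ (p ^ l)) (e s : ℕ) :
    coeff (rowExponent k n fun j => j - 1) (rowVand (Polynomial ℂ) k n) *
        evalQ ζ e (Ts p r₀ q₀ k n (l + s)) =
      evalQ ζ e (Ts p r₀ q₀ k n l) * evalQ 1 (e * p ^ l) (Ts p r₀ q₀ k n s) := by
  have hp : 0 < p := hodd.pos
  have hP : 0 < p ^ l := pow_pos hp l
  have hkk : dimv k n k = k := by simp only [dimv]; omega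
  have hnk : dimv k n (n - k) = k := by simp only [dimv]; omega
  have hζ' : IsPrimitiveRoot (Polynomial.C ζ) (p ^ l) :=
    hζ.map_of_injective Polynomial.C_injective
  set H := superpot k n (Polynomial.X ^ e) (Polynomial.C ζ)
    (aExp p r₀ q₀ l) (bExp p r₀ q₀ l) (cExp p r₀ q₀ l) with hH
  have hdeg (i j : ℕ) (hj : j ∈ Icc 1 (dimv k n i)) :
      degreeOf (i, j) (rowVand (Polynomial ℂ) k n * H) <
        dimv k n i * p ^ l + (p ^ l - 1) := by
    have h₁ := degreeOf_rowVand_lt (R := Polynomial ℂ) hj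
    have h₂ := degreeOf_superpot_le hk hn (Polynomial.X ^ e) (Polynomial.C ζ)
      (aExp p r₀ q₀ l) (bExp p r₀ q₀ l) (cExp p r₀ q₀ l) hj
    refine (degreeOf_mul_le _ _ _).trans_lt ?_
    rw [← hH] at h₂
    rw [aExp_eq hodd hq₀ hω hcong] at h₂
    rw [pow_eq_bExp_cExp hodd hq₀ hω hcong l]
    obtain ⟨v, hv⟩ : ∃ v, dimv k n i = v + 1 := ⟨dimv k n i - 1, by omega⟩
    rw [hv] at h₁ h₂ ⊢
    rw [Nat.add_sub_cancel] at h₂ ⊢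
    nlinarith
  have hl : (rowExponent k n fun j => j * p ^ l - 1) =
      p ^ l • (rowExponent k n fun j => j - 1) + rowExponent k n fun _ => p ^ l - 1 := by
    simpa using rowExponent_mul_pow hp k n l 0
  rw [evalQ_Ts, evalQ_Ts, evalQ_Ts, aExp_add hodd hq₀ hω hcong, bExp_add hodd hq₀ hω hcong,
    cExp_add hodd hq₀ hω hcong, superpot_mul_add k n _ _ hζ' hP, rowExponent_mul_pow hp, ← hH,
    mul_left_comm (rowVand _ k n), hl, ← pow_mul, map_one, mul_comm (rowVand _ k n)
      (superpot k n (Polynomial.X ^ (e * p ^ l)) _ _ _ _)]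
  refine coeff_expand_mul (fun x => ?_) (fun u => ?_) _ _
  · rw [rowExponent_apply]
    split_ifs <;> omega
  · rcases coeff_alternating (fun π hπ => rename_superpot hπ hkk hnk _ _ _ _ _) hdeg
      (superpot_mem_supported hkk hnk _ _ _ _ _) hP u with ⟨h₁, h₂⟩ | ⟨ε, h₁, h₂⟩
    · rw [h₁, h₂, mul_zero, mul_zero]
    · rw [h₁, h₂]
      ring

end Truncation

/-- For `l ≥ 1`, `ζ` a primitive `p^l`-th root of unity and every `s ≥ l`, one has
`T_{s+1}(z,ζ)·T_l(z^p,ζ^p) = T_{l+1}(z,ζ)·T_s(z^p,ζ^p)` in `ℂ[z]`; i.e. the ratio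
`T_{s+1}(z,ζ)/T_s(z^p,ζ^p)` is independent of `s ≥ l`, so the limit `λ(z,ζ)` exists
and is a rational function of `z`. -/
theorem ratio_stabilizes_at_primitive_root (p r₀ q₀ k n : ℕ) (hp : p.Prime) (hodd : Odd p)
    (hr₀ : 0 < r₀) (hq₀ : 0 < q₀) (hω : 2 * r₀ ≤ q₀) (hcong : p ≡ 1 [MOD q₀])
    (hk : 1 ≤ k) (hn : 2 * k ≤ n) (l : ℕ) (hl : 1 ≤ l)
    (ζ : ℂ) (hζ : IsPrimitiveRoot ζ (p ^ l)) (s : ℕ) (hs : l ≤ s) :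
    evalQ ζ 1 (Ts p r₀ q₀ k n (s + 1)) * evalQ (ζ ^ p) p (Ts p r₀ q₀ k n l) =
      evalQ ζ 1 (Ts p r₀ q₀ k n (l + 1)) * evalQ (ζ ^ p) p (Ts p r₀ q₀ k n s) := by
  set t := coeff (rowExponent k n fun j => j - 1) (rowVand (Polynomial ℂ) k n) with ht
  have ht0 : t ≠ 0 := coeff_rowVand_ne_zero
  obtain ⟨d, rfl⟩ := Nat.exists_eq_add_of_le hs
  obtain ⟨m, rfl⟩ := Nat.exists_eq_add_of_le' hl
  have hζp : IsPrimitiveRoot (ζ ^ p) (p ^ m) :=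
    hζ.pow (pow_pos hp.pos _) (pow_succ' p m)
  have h₁ := evalQ_Ts_add hodd hq₀ hω hcong hk hn hζ 1 (d + 1)
  have h₂ := evalQ_Ts_add hodd hq₀ hω hcong hk hn hζp p 1
  have h₃ := evalQ_Ts_add hodd hq₀ hω hcong hk hn hζ 1 1
  have h₄ := evalQ_Ts_add hodd hq₀ hω hcong hk hn hζp p (d + 1)
  rw [show m + (d + 1) = m + 1 + d by ring, ← pow_succ'] at h₄
  rw [← pow_succ'] at h₂
  rw [one_mul, ← ht] at h₁ h₃
  rw [← ht] at h₂ h₄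
  rw [← add_assoc] at h₁
  apply mul_left_cancel₀ (mul_ne_zero ht0 ht0)
  rw [mul_mul_mul_comm, h₁, h₂, mul_mul_mul_comm t t, h₃, h₄]
  ring
end

section
/- Let 1 ≤ l ≤ s and let ζ ∈ ℂ be a primitive p^l-th root of unity. Then, evaluating q at ζ, the factorization Φ̄_s(x, z, ζ) = Φ̄_l(x, z, ζ) · Φ̄_{s−l}(x^{p^l}, z^{p^l}, 1) holds in the polynomial ring ℂ[x, z], where x^{p^l} denotes the substitution replacing every variable x_{i,j} by x_{i,j}^{p^l}. -/
open MvPolynomial Finset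

/-- The substitution `ℤ[x,z,q] → ℂ[x,z]` sending `q ↦ ζ`, `z ↦ z^e`, and every
variable `x_{i,j} ↦ x_{i,j}^e`. -/
noncomputable def substC (ζ : ℂ) (e : ℕ) :
    MvPolynomial (ℕ × ℕ) Zq →+* MvPolynomial (ℕ × ℕ) (Polynomial ℂ) :=
  MvPolynomial.eval₂Hom
    ((MvPolynomial.C : Polynomial ℂ →+* MvPolynomial (ℕ × ℕ) (Polynomial ℂ)).comp
      (MvPolynomial.eval₂Hom (Int.castRingHom (Polynomial ℂ))
        (fun b => bif b then Polynomial.C ζ else Polynomial.X ^ e)))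
    (fun ij => MvPolynomial.X ij ^ e)

/-- The product of `x - ζ^r y` over a full period of residues. -/
theorem prod_range_sub_pow_mul {R : Type*} [CommRing R] [IsDomain R] {N : ℕ} (hN : 0 < N)
    {ζ : R} (hζ : IsPrimitiveRoot ζ N) (x y : R) :
    ∏ r ∈ range N, (x - ζ ^ r * y) = x ^ N - y ^ N := by
  classical
  have hinj : Set.InjOn (fun r => ζ ^ r) (range N) := fun a ha b hb hab =>
    hζ.pow_inj (Finset.mem_range.mp ha) (Finset.mem_range.mp hb) hab
  have himage : (range N).image (fun r => ζ ^ r) = Polynomial.nthRootsFinset N (1 : R) := by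
    refine Finset.eq_of_subset_of_card_le ?_ ?_
    · intro a ha
      obtain ⟨r, -, rfl⟩ := Finset.mem_image.mp ha
      rw [Polynomial.mem_nthRootsFinset hN, ← pow_mul, mul_comm, pow_mul, hζ.pow_eq_one, one_pow]
    · rw [hζ.card_nthRootsFinset, Finset.card_image_of_injOn hinj, card_range]
  rw [hζ.pow_sub_pow_eq_prod_sub_mul x y hN, ← himage, Finset.prod_image hinj]

theorem prod_range_mul_add_sub_pow_mul {R : Type*} [CommRing R] [IsDomain R] {N : ℕ} (hN : 0 < N)
    {ζ : R} (hζ : IsPrimitiveRoot ζ N) (x y : R) (d c : ℕ) :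
    ∏ r ∈ range (N * c + d), (x - ζ ^ r * y) =
      (∏ r ∈ range d, (x - ζ ^ r * y)) * (x ^ N - y ^ N) ^ c := by
  induction c with
  | zero => simp
  | succ c ih =>
    rw [show N * (c + 1) + d = N + (N * c + d) by ring, prod_range_add]
    simp only [pow_add ζ N, hζ.pow_eq_one, one_mul]
    rw [ih, prod_range_sub_pow_mul hN hζ, pow_succ]
    ring

theorem cExp_eq {p r₀ q₀ s u : ℕ} (hq₀ : 0 < q₀) (hu : p ^ s = q₀ * u + 1) :
    cExp p r₀ q₀ s = u * r₀ := by
  unfold cExp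
  rw [hu, Nat.add_sub_cancel, mul_assoc, Nat.mul_div_cancel_left _ hq₀]

theorem exists_pow_eq_mul_add_one {p d : ℕ} (hp : 0 < p) (hcong : p ≡ 1 [MOD d]) (s : ℕ) :
    ∃ u, p ^ s = d * u + 1 := by
  have h : 1 ≡ p ^ s [MOD d] := by simpa using (hcong.pow s).symm
  obtain ⟨u, hu⟩ := (Nat.modEq_iff_dvd' (Nat.one_le_pow _ _ hp)).mp h
  exact ⟨u, by have := Nat.one_le_pow s p hp; omega⟩

/-- The exponents `c`, `a`, `b` all satisfy `e_{l+t} = p^l e_t + e_l`. -/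
theorem exponents_add {p r₀ q₀ : ℕ} (hp : 0 < p) (hodd : Odd p) (hq₀ : 0 < q₀)
    (hω : 2 * r₀ ≤ q₀) (hcong : p ≡ 1 [MOD q₀]) (l t : ℕ) :
    cExp p r₀ q₀ (l + t) = p ^ l * cExp p r₀ q₀ t + cExp p r₀ q₀ l ∧
    aExp p r₀ q₀ (l + t) = p ^ l * aExp p r₀ q₀ t + aExp p r₀ q₀ l ∧
    bExp p r₀ q₀ (l + t) = p ^ l * bExp p r₀ q₀ t + bExp p r₀ q₀ l := by
  have key : ∀ s, ∃ a b, p ^ s - 1 = a + cExp p r₀ q₀ s ∧ aExp p r₀ q₀ s = a ∧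
      p ^ s - 1 = 2 * b + 2 * cExp p r₀ q₀ s ∧ bExp p r₀ q₀ s = b := by
    intro s
    obtain ⟨u, hu⟩ := exists_pow_eq_mul_add_one hp hcong s
    obtain ⟨w, hw⟩ := hodd.pow (n := s)
    have hc := cExp_eq (r₀ := r₀) hq₀ hu
    have hle : 2 * cExp p r₀ q₀ s ≤ p ^ s - 1 := by
      rw [hc, hu, Nat.add_sub_cancel]
      nlinarith [Nat.mul_le_mul_right u hω]
    refine ⟨_, _, ?_, rfl, ?_, rfl⟩ <;> simp only [aExp, bExp] <;> omega
  have hc : cExp p r₀ q₀ (l + t) = p ^ l * cExp p r₀ q₀ t + cExp p r₀ q₀ l := by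
    obtain ⟨u, hu⟩ := exists_pow_eq_mul_add_one hp hcong l
    obtain ⟨v, hv⟩ := exists_pow_eq_mul_add_one hp hcong t
    have hsum : p ^ (l + t) = q₀ * (p ^ l * v + u) + 1 := by
      rw [pow_add, hv]
      linear_combination hu
    rw [cExp_eq hq₀ hsum, cExp_eq hq₀ hu, cExp_eq hq₀ hv]
    ring
  have hpow : p ^ (l + t) - 1 = p ^ l * (p ^ t - 1) + (p ^ l - 1) := by
    obtain ⟨x, hx⟩ := Nat.exists_eq_add_of_le' (Nat.one_le_pow l p hp)
    obtain ⟨y, hy⟩ := Nat.exists_eq_add_of_le' (Nat.one_le_pow t p hp)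
    rw [pow_add, hx, hy, Nat.add_sub_cancel, Nat.add_sub_cancel,
      Nat.sub_eq_iff_eq_add (by nlinarith)]
    ring
  obtain ⟨a₁, b₁, ha₁, ha₁', hb₁, hb₁'⟩ := key l
  obtain ⟨a₂, b₂, ha₂, ha₂', hb₂, hb₂'⟩ := key t
  obtain ⟨a₃, b₃, ha₃, ha₃', hb₃, hb₃'⟩ := key (l + t)
  refine ⟨hc, ?_, ?_⟩
  · rw [ha₁', ha₂', ha₃']
    rw [hpow, hc, ha₁, ha₂] at ha₃
    linarith
  · rw [hb₁', hb₂', hb₃']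
    rw [hpow, hc, hb₁, hb₂] at hb₃
    linarith

@[simp] theorem substC_X (ζ : ℂ) (e : ℕ) (v : ℕ × ℕ) : substC ζ e (X v) = X v ^ e := by
  simp [substC]

@[simp] theorem substC_C_Zvar (ζ : ℂ) (e : ℕ) :
    substC ζ e (C Zvar) = C Polynomial.X ^ e := by
  simp [substC, Zvar]

@[simp] theorem substC_C_Qvar (ζ : ℂ) (e : ℕ) :
    substC ζ e (C Qvar) = C (Polynomial.C ζ) := by
  simp [substC, Qvar]

/-- Factorization at a primitive `p^l`-th root of unity `ζ` (with `1 ≤ l ≤ s`):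
`Φ̄_s(x,z,ζ) = Φ̄_l(x,z,ζ) · Φ̄_{s-l}(x^{p^l}, z^{p^l}, 1)` in `ℂ[x,z]`. -/
theorem phibar_factorization (p r₀ q₀ k n : ℕ) (hp : p.Prime) (hodd : Odd p)
    (hr₀ : 0 < r₀) (hq₀ : 0 < q₀) (hω : 2 * r₀ ≤ q₀) (hcong : p ≡ 1 [MOD q₀])
    (hk : 1 ≤ k) (hn : 2 * k ≤ n) (l s : ℕ) (hl : 1 ≤ l) (hls : l ≤ s)
    (ζ : ℂ) (hζ : IsPrimitiveRoot ζ (p ^ l)) :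
    substC ζ 1 (Phibar p r₀ q₀ k n s) =
      substC ζ 1 (Phibar p r₀ q₀ k n l) * substC 1 (p ^ l) (Phibar p r₀ q₀ k n (s - l)) := by
  obtain ⟨t, rfl⟩ := Nat.exists_eq_add_of_le hls
  rw [Nat.add_sub_cancel_left]
  obtain ⟨hc, ha, hb⟩ := exponents_add hp.pos hodd hq₀ hω hcong l t
  have hN : 0 < p ^ l := pow_pos hp.pos l
  have hinj : Function.Injective
      ((C : Polynomial ℂ →+* MvPolynomial (ℕ × ℕ) (Polynomial ℂ)).comp Polynomial.C) :=
    (C_injective _ _).comp Polynomial.C_injective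
  have hζ' : IsPrimitiveRoot (C (Polynomial.C ζ) : MvPolynomial (ℕ × ℕ) (Polynomial ℂ)) (p ^ l) :=
    hζ.map_of_injective hinj
  have hprod := prod_range_mul_add_sub_pow_mul hN hζ'
  simp only [Phibar, hc, ha, hb, map_mul, map_prod, map_pow, map_sub, map_one, substC_X,
    substC_C_Zvar, substC_C_Qvar, pow_one, prod_mul_distrib, hprod, one_pow, one_mul,
    prod_const, card_range, prod_pow, pow_add, pow_mul]
  ring
end

section
/- Let p be an odd prime and for s ≥ 0 set T_s(z) := Σ_{n=0}^{p^s−1} binom(−1/2, n)² zⁿ, a polynomial with coefficients in ℤ_p (the coefficients binom(−1/2, n) = (−1/2)(−1/2 − 1)⋯(−1/2 − n + 1)/n! are p-adic integers for p odd). Then for every s ≥ 1, p^s divides T_{s+1}(z)·T_{s−1}(z^p) − T_s(z)·T_s(z^p) in ℤ_p[z]. -/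
open Finset

/-- The `p`-adic integer `binom(-1/2, n) = (-1)^n · binom(2n, n) / 4^n`. -/
noncomputable def binomHalf (p : ℕ) [Fact p.Prime] (n : ℕ) : ℤ_[p] :=
  (-1) ^ n * (Nat.centralBinom n : ℤ_[p]) * Ring.inverse ((4 : ℤ_[p]) ^ n)

/-- The Dwork truncation `T_s(z) = Σ_{n=0}^{p^s-1} binom(-1/2,n)² zⁿ ∈ ℤ_p[z]`. -/
noncomputable def dworkT (p : ℕ) [Fact p.Prime] (s : ℕ) : Polynomial ℤ_[p] :=
  ∑ n ∈ range (p ^ s), Polynomial.C (binomHalf p n ^ 2) * Polynomial.X ^ n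

section FrobeniusLift

variable {R : Type*} [CommRing R]

/-- A ring endomorphism lifting the `p`-th power Frobenius modulo `p`. -/
def IsFrobeniusLift (p : ℕ) (Φ : R →+* R) : Prop :=
  ∀ x, (p : R) ∣ x ^ p - Φ x

lemma dvd_add_pow_sub_map_add {p : ℕ} (hp : p.Prime) (Φ : R →+* R) {x y : R}
    (hx : (p : R) ∣ x ^ p - Φ x) (hy : (p : R) ∣ y ^ p - Φ y) :
    (p : R) ∣ (x + y) ^ p - Φ (x + y) := by
  obtain ⟨r, hr⟩ := exists_add_pow_prime_eq hp x y
  have h : (x + y) ^ p - Φ (x + y) = (x ^ p - Φ x) + (y ^ p - Φ y) + p * (x * y * r) := by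
    rw [hr, map_add]; ring
  rw [h]
  exact dvd_add (dvd_add hx hy) (dvd_mul_right _ _)

lemma dvd_mul_pow_sub_map_mul {p : ℕ} (Φ : R →+* R) {x y : R}
    (hx : (p : R) ∣ x ^ p - Φ x) (hy : (p : R) ∣ y ^ p - Φ y) :
    (p : R) ∣ (x * y) ^ p - Φ (x * y) := by
  have h : (x * y) ^ p - Φ (x * y) = (x ^ p - Φ x) * y ^ p + Φ x * (y ^ p - Φ y) := by
    rw [map_mul]; ring
  rw [h]
  exact dvd_add (hx.mul_right _) (hy.mul_left _)

lemma IsFrobeniusLift.dvd_pow_sub_iterate {p : ℕ} {Φ : R →+* R} (hΦ : IsFrobeniusLift p Φ)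
    (x : R) (k : ℕ) : (p : R) ∣ x ^ p ^ (k + 1) - (Φ ^ (k + 1)) x := by
  induction k with
  | zero => simpa using hΦ x
  | succ k ih =>
    have h1 : (p : R) ∣ (x ^ p ^ (k + 1)) ^ p - ((Φ ^ (k + 1)) x) ^ p :=
      ih.trans (sub_dvd_pow_sub_pow _ _ _)
    have h2 := dvd_add h1 (hΦ ((Φ ^ (k + 1)) x))
    rw [sub_add_sub_cancel, ← pow_mul, ← pow_succ] at h2
    rwa [pow_succ' Φ (k + 1)]

/-- The truncated geometric series `∑_{n < p ^ s} Lⁿ`. -/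
def truncGeom (p : ℕ) (L : R) (s : ℕ) : R := ∑ n ∈ range (p ^ s), L ^ n

/-- The top-digit factor `∑_{a < p} L ^ (a p ^ s)`. -/
def digitFactor (p : ℕ) (L : R) (s : ℕ) : R := ∑ a ∈ range p, (L ^ a) ^ p ^ s

lemma truncGeom_succ (p : ℕ) (L : R) (s : ℕ) :
    truncGeom p L (s + 1) = truncGeom p L s * digitFactor p L s := by
  have h : ∀ m, ∑ n ∈ range (p ^ s * m), L ^ n =
      truncGeom p L s * ∑ a ∈ range m, (L ^ a) ^ p ^ s := by
    intro m
    induction m with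
    | zero => simp
    | succ m ih =>
      rw [mul_add, mul_one, sum_range_add, ih, sum_range_succ, mul_add, truncGeom]
      congr 1
      rw [sum_mul]
      refine sum_congr rfl fun i _ ↦ ?_
      rw [pow_add, ← pow_mul L m, mul_comm m, mul_comm]
  exact h p

/-- The ghost terms of the sequence of truncated geometric series, defined so that
`truncGeom p L (s + 1) = ∑_{k ≤ s} ghost k * Φ ^ (k + 1) (truncGeom p L (s - k))`. -/
def ghostTerm (p : ℕ) (Φ : R →+* R) (L : R) (s : ℕ) : R :=
  truncGeom p L (s + 1) -
    ∑ k : Fin s, ghostTerm p Φ L k * (Φ ^ ((k : ℕ) + 1)) (truncGeom p L (s - k))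
termination_by s
decreasing_by exact k.2

lemma ghostTerm_eq (p : ℕ) (Φ : R →+* R) (L : R) (s : ℕ) :
    ghostTerm p Φ L s = truncGeom p L (s + 1) -
      ∑ k ∈ range s, ghostTerm p Φ L k * (Φ ^ (k + 1)) (truncGeom p L (s - k)) := by
  rw [ghostTerm, ← Fin.sum_univ_eq_sum_range
    (fun k ↦ ghostTerm p Φ L k * (Φ ^ (k + 1)) (truncGeom p L (s - k)))]

lemma truncGeom_zero (p : ℕ) (L : R) : truncGeom p L 0 = 1 := by simp [truncGeom]

lemma truncGeom_eq_sum_ghostTerm (p : ℕ) (Φ : R →+* R) (L : R) (s : ℕ) :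
    truncGeom p L (s + 1) =
      ∑ k ∈ range (s + 1), ghostTerm p Φ L k * (Φ ^ (k + 1)) (truncGeom p L (s - k)) := by
  rw [sum_range_succ, ghostTerm_eq p Φ L s, Nat.sub_self, truncGeom_zero, map_one]
  ring

lemma IsFrobeniusLift.pow_dvd_digitFactor_sub {p : ℕ} {Φ : R →+* R} (hΦ : IsFrobeniusLift p Φ)
    (L : R) (k m : ℕ) :
    (p : R) ^ (m + 1) ∣
      digitFactor p L (k + 1 + m) - (Φ ^ (k + 1)) (digitFactor p L m) := by
  rw [digitFactor, digitFactor, map_sum, ← sum_sub_distrib]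
  refine dvd_sum fun a _ ↦ ?_
  rw [map_pow, pow_add p, pow_mul]
  exact dvd_sub_pow_of_dvd_sub (hΦ.dvd_pow_sub_iterate (L ^ a) k) m

lemma IsFrobeniusLift.pow_dvd_ghostTerm {p : ℕ} {Φ : R →+* R} (hΦ : IsFrobeniusLift p Φ)
    (L : R) (s : ℕ) : (p : R) ^ s ∣ ghostTerm p Φ L s := by
  induction s using Nat.strong_induction_on with
  | _ s ih =>
  cases s with
  | zero => simp
  | succ s =>
    have h : ghostTerm p Φ L (s + 1) = ∑ k ∈ range (s + 1),
        ghostTerm p Φ L k * ((Φ ^ (k + 1)) (truncGeom p L (s - k)) *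
          (digitFactor p L (s + 1) - (Φ ^ (k + 1)) (digitFactor p L (s - k)))) := by
      rw [ghostTerm_eq, truncGeom_succ, truncGeom_eq_sum_ghostTerm p Φ, sum_mul,
        ← sum_sub_distrib]
      refine sum_congr rfl fun k hk ↦ ?_
      rw [Nat.succ_sub (Nat.lt_succ_iff.1 (mem_range.1 hk)), truncGeom_succ, map_mul]
      ring
    rw [h]
    refine dvd_sum fun k hk ↦ ?_
    obtain ⟨m, rfl⟩ := Nat.exists_eq_add_of_le (Nat.lt_succ_iff.1 (mem_range.1 hk))
    rw [Nat.add_sub_cancel_left, add_assoc, pow_add]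
    refine mul_dvd_mul (ih k (mem_range.1 hk)) (Dvd.dvd.mul_left ?_ _)
    have := hΦ.pow_dvd_digitFactor_sub L k m
    rwa [show k + (m + 1) = k + 1 + m by ring]

end FrobeniusLift

section Recursion

variable {S : Type*} [CommRing S] [IsDomain S]

/-- Dwork congruences follow from a decomposition of `T` into `p`-adically small ghost terms. -/
theorem dvd_of_ghost_decomposition {p : ℕ} (hp : Prime (p : S)) (φ : S →+* S) (T C : ℕ → S)
    (hC : ∀ k, (p : S) ^ k ∣ C k)
    (hT : ∀ s, T (s + 1) = ∑ k ∈ range (s + 1), C k * (φ ^ (k + 1)) (T (s - k)))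
    (hunit : ∀ s, ¬ (p : S) ∣ φ (T s)) (s : ℕ) :
    (p : S) ^ (s + 1) ∣ T (s + 2) * φ (T s) - T (s + 1) * φ (T (s + 1)) := by
  induction s using Nat.strong_induction_on with
  | _ s ih =>
  have chain : ∀ k m, m + k ≤ s →
      (p : S) ^ (m + 1) ∣ (φ ^ k) (T (m + 1)) * T (m + k) - (φ ^ k) (T m) * T (m + k + 1) := by
    intro k
    induction k with
    | zero => intro m _; simp [mul_comm]
    | succ k ihk =>
      intro m hm
      have h1 : (p : S) ^ (m + 1) ∣
          T (m + k + 2) * φ (T (m + k)) - T (m + k + 1) * φ (T (m + k + 1)) :=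
        (pow_dvd_pow _ (by lia)).trans (ih (m + k) (by lia))
      have h2 := map_dvd φ (ihk m (by lia))
      simp only [map_pow, map_natCast, map_sub, map_mul] at h2
      refine hp.pow_dvd_of_dvd_mul_right (m + 1) (hunit (m + k)) ?_
      have h3 := dvd_sub (h2.mul_left (T (m + k + 1)))
        (h1.mul_left (φ ((φ ^ k) (T m))))
      convert h3 using 1
      rw [pow_succ' φ k]
      simp only [RingHom.mul_def, RingHom.comp_apply, ← add_assoc]
      ring
  have h : T (s + 2) * φ (T s) - T (s + 1) * φ (T (s + 1)) =
      ∑ k ∈ range (s + 1), C k * φ ((φ ^ k) (T (s + 1 - k)) * T s - (φ ^ k) (T (s - k)) * T (s + 1))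
        + C (s + 1) * ((φ ^ (s + 2)) (T 0) * φ (T s)) := by
    have hs : T (s + 1) * φ (T (s + 1)) =
        ∑ k ∈ range (s + 1), C k * (φ ^ (k + 1)) (T (s - k)) * φ (T (s + 1)) := by
      rw [← sum_mul, ← hT]
    rw [hT (s + 1), sum_range_succ, hs, Nat.sub_self, add_mul, sum_mul, add_sub_right_comm,
      ← sum_sub_distrib]
    congr 1
    · refine sum_congr rfl fun k _ ↦ ?_
      rw [pow_succ' φ k]
      simp only [RingHom.mul_def, RingHom.comp_apply, map_sub, map_mul]
      ring
    · ring
  rw [h]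
  refine dvd_add (dvd_sum fun k hk ↦ ?_) ((hC _).mul_right _)
  obtain ⟨m, rfl⟩ := Nat.exists_eq_add_of_le (Nat.lt_succ_iff.1 (mem_range.1 hk))
  have h2 := map_dvd φ (chain k m (by lia))
  simp only [map_pow, map_natCast] at h2
  rw [add_assoc, pow_add, Nat.add_sub_cancel_left, Nat.add_sub_cancel_left, ← add_assoc,
    add_comm k m]
  exact mul_dvd_mul (hC k) h2

end Recursion

section Laurent

open AddMonoidAlgebra

variable {S : Type*} [CommRing S]

/-- Laurent polynomials in two variables with all exponents in `[-N, N]`. -/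
def laurentBox (S : Type*) [CommRing S] (N : ℕ) : Submodule S (AddMonoidAlgebra S (ℤ × ℤ)) where
  carrier := {f | ∀ g, g ∉ Set.Icc (-(N : ℤ), -(N : ℤ)) ((N : ℤ), (N : ℤ)) → f.coeff g = 0}
  zero_mem' := by simp
  add_mem' := by
    intro a b ha hb g hg
    simp [ha g hg, hb g hg]
  smul_mem' := by
    intro c a ha g hg
    simp [ha g hg]

lemma single_mem_laurentBox {N : ℕ} {g : ℤ × ℤ}
    (hg : g ∈ Set.Icc (-(N : ℤ), -(N : ℤ)) ((N : ℤ), (N : ℤ))) (r : S) :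
    single g r ∈ laurentBox S N := by
  intro h hh
  rw [coeff_single, Finsupp.single_apply, if_neg]
  rintro rfl
  exact hh hg

lemma laurentBox_mono {M N : ℕ} (h : M ≤ N) : laurentBox S M ≤ laurentBox S N := by
  intro f hf g hg
  refine hf g fun hg' ↦ hg ?_
  simp only [Set.mem_Icc, Prod.le_def] at hg' ⊢
  lia

lemma mem_Icc_of_mem_laurentBox {N : ℕ} {f : AddMonoidAlgebra S (ℤ × ℤ)} (hf : f ∈ laurentBox S N)
    {g : ℤ × ℤ} (hg : g ∈ f.coeff.support) :
    g ∈ Set.Icc (-(N : ℤ), -(N : ℤ)) ((N : ℤ), (N : ℤ)) := by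
  by_contra h
  exact (Finsupp.mem_support_iff.1 hg) (hf g h)

lemma mul_mem_laurentBox {M N : ℕ} {f g : AddMonoidAlgebra S (ℤ × ℤ)}
    (hf : f ∈ laurentBox S M) (hg : g ∈ laurentBox S N) : f * g ∈ laurentBox S (M + N) := by
  intro x hx
  by_contra h
  obtain ⟨a, ha, b, hb, rfl⟩ :=
    Finset.mem_add.1 (support_coeff_mul_subset f g (Finsupp.mem_support_iff.2 h))
  have ha' := mem_Icc_of_mem_laurentBox hf ha
  have hb' := mem_Icc_of_mem_laurentBox hg hb
  refine hx ?_
  simp only [Set.mem_Icc, Prod.le_def, Prod.fst_add, Prod.snd_add] at ha' hb' ⊢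
  lia

/-- The endomorphism of Laurent polynomials acting by `φ` on coefficients and raising the
variables to the `p`-th power. -/
noncomputable def laurentFrobenius (p : ℕ) (φ : S →+* S) :
    AddMonoidAlgebra S (ℤ × ℤ) →+* AddMonoidAlgebra S (ℤ × ℤ) :=
  (mapDomainRingHom S (nsmulAddMonoidHom p : ℤ × ℤ →+ ℤ × ℤ)).comp (mapRingHom (ℤ × ℤ) φ)

lemma laurentFrobenius_single (p : ℕ) (φ : S →+* S) (g : ℤ × ℤ) (r : S) :
    laurentFrobenius p φ (single g r) = single (p • g) (φ r) := by
  simp [laurentFrobenius]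

lemma laurentFrobenius_pow_single (p : ℕ) (φ : S →+* S) (k : ℕ) (g : ℤ × ℤ) (r : S) :
    (laurentFrobenius p φ ^ k) (single g r) = single (p ^ k • g) ((φ ^ k) r) := by
  induction k with
  | zero => simp
  | succ k ih =>
    rw [pow_succ', RingHom.mul_def, RingHom.comp_apply, ih, laurentFrobenius_single, pow_succ' φ,
      ← mul_smul, ← pow_succ']
    rfl

lemma laurentFrobenius_pow_mem {N : ℕ} (p : ℕ) (φ : S →+* S) (k : ℕ)
    {f : AddMonoidAlgebra S (ℤ × ℤ)} (hf : f ∈ laurentBox S N) :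
    (laurentFrobenius p φ ^ k) f ∈ laurentBox S (p ^ k * N) := by
  rw [← sum_coeff_single f, Finsupp.sum, map_sum]
  refine sum_mem fun g hg ↦ ?_
  rw [laurentFrobenius_pow_single]
  refine single_mem_laurentBox ?_ _
  have hg' := mem_Icc_of_mem_laurentBox hf hg
  simp only [Set.mem_Icc, Prod.le_def, Prod.smul_fst, Prod.smul_snd, ← natCast_zsmul, smul_eq_mul] at hg' ⊢
  push_cast
  have : (0 : ℤ) ≤ (p : ℤ) ^ k := by positivity
  refine ⟨⟨?_, ?_⟩, ?_, ?_⟩ <;> nlinarith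

lemma isFrobeniusLift_laurentFrobenius {p : ℕ} (hp : p.Prime) {φ : S →+* S}
    (hφ : IsFrobeniusLift p φ) : IsFrobeniusLift p (laurentFrobenius p φ) := by
  intro f
  induction f using AddMonoidAlgebra.induction_linear with
  | zero => simp [hp.ne_zero]
  | add f g hf hg => exact dvd_add_pow_sub_map_add hp _ hf hg
  | single g r =>
    obtain ⟨c, hc⟩ := hφ r
    refine ⟨single (p • g) c, ?_⟩
    rw [laurentFrobenius_single, single_pow, ← single_sub, hc, ← nsmul_eq_mul, ← nsmul_eq_mul,
      smul_single]

/-- The constant term of a Laurent polynomial. -/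
noncomputable def constTerm (S : Type*) [CommRing S] : AddMonoidAlgebra S (ℤ × ℤ) →+ S where
  toFun f := f.coeff 0
  map_zero' := rfl
  map_add' _ _ := rfl

lemma constTerm_single (g : ℤ × ℤ) (r : S) :
    constTerm S (single g r) = if g = 0 then r else 0 := by
  exact Finsupp.single_apply

lemma constTerm_mul_single (f : AddMonoidAlgebra S (ℤ × ℤ)) (g : ℤ × ℤ) (r : S) :
    constTerm S (f * single g r) = f.coeff (-g) * r := by
  exact coeff_mul_single_eq_coeff_mul _ fun _ _ ↦ by rw [eq_neg_iff_add_eq_zero]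

lemma constTerm_mul_laurentFrobenius {p k : ℕ} (hp : p.Prime) (φ : S →+* S)
    {J : AddMonoidAlgebra S (ℤ × ℤ)} (hJ : J ∈ laurentBox S (p ^ k - 1))
    (f : AddMonoidAlgebra S (ℤ × ℤ)) :
    constTerm S (J * (laurentFrobenius p φ ^ k) f) = constTerm S J * (φ ^ k) (constTerm S f) := by
  induction f using AddMonoidAlgebra.induction_linear with
  | zero => simp
  | add f g hf hg => simp only [map_add, mul_add, hf, hg]
  | single g r =>
    rw [laurentFrobenius_pow_single, constTerm_mul_single, constTerm_single]
    by_cases hg : g = 0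
    · rw [hg, smul_zero, neg_zero, if_pos rfl]
      rfl
    · rw [if_neg hg, map_zero, mul_zero, hJ, zero_mul]
      contrapose! hg
      have hpos : 0 < p ^ k := pow_pos hp.pos k
      have hq : ((p ^ k - 1 : ℕ) : ℤ) < (p ^ k : ℕ) := by lia
      simp only [Set.mem_Icc, Prod.le_def, Prod.fst_neg, Prod.snd_neg, Prod.smul_fst,
        Prod.smul_snd, ← natCast_zsmul, smul_eq_mul] at hg
      obtain ⟨⟨h1, h2⟩, h3, h4⟩ := hg
      have key : ∀ x : ℤ, -((p ^ k - 1 : ℕ) : ℤ) ≤ -((p ^ k : ℕ) * x) →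
          -((p ^ k : ℕ) * x) ≤ ((p ^ k - 1 : ℕ) : ℤ) → x = 0 := by
        intro x hx hx'
        by_contra h
        rcases lt_or_gt_of_ne h with h | h <;> nlinarith
      exact Prod.ext (key _ h1 h3) (key _ h2 h4)

lemma pow_dvd_constTerm {p k : ℕ} {f : AddMonoidAlgebra S (ℤ × ℤ)}
    (h : (p : AddMonoidAlgebra S (ℤ × ℤ)) ^ k ∣ f) : (p : S) ^ k ∣ constTerm S f := by
  obtain ⟨g, rfl⟩ := h
  have h : (p : AddMonoidAlgebra S (ℤ × ℤ)) ^ k * g = (p ^ k) • g := by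
    rw [nsmul_eq_mul, Nat.cast_pow]
  rw [h, map_nsmul, nsmul_eq_mul, Nat.cast_pow]
  exact dvd_mul_right _ _

lemma ghostTerm_mem_laurentBox {p : ℕ} (hp : p.Prime) (φ : S →+* S)
    {L : AddMonoidAlgebra S (ℤ × ℤ)} (hL : ∀ n, L ^ n ∈ laurentBox S n) (s : ℕ) :
    ghostTerm p (laurentFrobenius p φ) L s ∈ laurentBox S (p ^ (s + 1) - 1) := by
  have hF : ∀ s, truncGeom p L s ∈ laurentBox S (p ^ s - 1) := fun s ↦
    sum_mem fun n hn ↦ laurentBox_mono (Nat.le_sub_one_of_lt (mem_range.1 hn)) (hL n)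
  induction s using Nat.strong_induction_on with
  | _ s ih =>
  rw [ghostTerm_eq]
  refine sub_mem (hF _) (sum_mem fun k hk ↦ ?_)
  have hk' := mem_range.1 hk
  refine laurentBox_mono (le_of_eq ?_)
    (mul_mem_laurentBox (ih k hk') (laurentFrobenius_pow_mem p φ (k + 1) (hF (s - k))))
  have h1 : p ^ (s + 1) = p ^ (k + 1) * p ^ (s - k) := by
    rw [← pow_add]; congr 1; lia
  have h2 : 0 < p ^ (k + 1) := pow_pos hp.pos _
  have h3 : 0 < p ^ (s - k) := pow_pos hp.pos _
  have h4 : p ^ (k + 1) ≤ p ^ (k + 1) * p ^ (s - k) := Nat.le_mul_of_pos_right _ h3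
  rw [h1, Nat.mul_sub, mul_one]
  lia

/-- The Laurent polynomial `q (1 + x)² (1 + y)² / (x y)`. -/
noncomputable def legendreLaurent (q : S) : AddMonoidAlgebra S (ℤ × ℤ) :=
  single (-1, -1) q * ((single (1, 0) 1 + 1) ^ 2 * (single (0, 1) 1 + 1) ^ 2)

lemma legendreLaurent_pow (q : S) (n : ℕ) :
    legendreLaurent q ^ n = ∑ k ∈ range (2 * n + 1), ∑ l ∈ range (2 * n + 1),
      single ((k : ℤ) - n, (l : ℤ) - n) (q ^ n * ((2 * n).choose k * (2 * n).choose l)) := by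
  rw [legendreLaurent, mul_pow, mul_pow, ← pow_mul, ← pow_mul, add_pow, add_pow, sum_mul_sum,
    mul_sum]
  refine sum_congr rfl fun k _ ↦ ?_
  rw [mul_sum]
  refine sum_congr rfl fun l _ ↦ ?_
  have hcast : ∀ m : ℕ, (m : AddMonoidAlgebra S (ℤ × ℤ)) = single 0 (m : S) := fun m ↦ by
    rw [natCast_def]
  simp only [single_pow, one_pow, mul_one, hcast, single_mul_single]
  congr 1
  · ext <;> simp <;> ring
  · ring

lemma legendreLaurent_pow_mem (q : S) (n : ℕ) : legendreLaurent q ^ n ∈ laurentBox S n := by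
  rw [legendreLaurent_pow]
  refine sum_mem fun k hk ↦ sum_mem fun l hl ↦ single_mem_laurentBox ?_ _
  rw [mem_range] at hk hl
  simp only [Set.mem_Icc, Prod.le_def]
  lia

lemma constTerm_legendreLaurent_pow (q : S) (n : ℕ) :
    constTerm S (legendreLaurent q ^ n) = q ^ n * (n.centralBinom : S) ^ 2 := by
  rw [legendreLaurent_pow, map_sum]
  simp only [map_sum, constTerm_single, Prod.mk_eq_zero, sub_eq_zero, Nat.cast_inj]
  rw [sum_eq_single n, sum_eq_single n]
  · simp [Nat.centralBinom, sq]
  · intro l _ hl; simp [hl]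
  · intro h; exact absurd (mem_range.2 (by lia)) h
  · intro k _ hk; simp [hk]
  · intro h; exact absurd (mem_range.2 (by lia)) h

end Laurent

section PadicPolynomial

open Polynomial

variable (p : ℕ) [Fact p.Prime]

lemma PadicInt.dvd_pow_sub_self (x : ℤ_[p]) : (p : ℤ_[p]) ∣ x ^ p - x := by
  rw [← Ideal.mem_span_singleton, ← PadicInt.maximalIdeal_eq_span_p, ← PadicInt.ker_toZMod,
    RingHom.mem_ker, map_sub, map_pow, ZMod.pow_card, sub_self]

lemma isFrobeniusLift_expand :
    IsFrobeniusLift p (expand ℤ_[p] p : ℤ_[p][X] →+* ℤ_[p][X]) := by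
  have hp : p.Prime := Fact.out
  intro f
  induction f using Polynomial.induction_on' with
  | add f g hf hg => exact dvd_add_pow_sub_map_add hp _ hf hg
  | monomial n a =>
    rw [← C_mul_X_pow_eq_monomial]
    refine dvd_mul_pow_sub_map_mul _ ?_ ?_
    · obtain ⟨c, hc⟩ := PadicInt.dvd_pow_sub_self p a
      refine ⟨C c, ?_⟩
      simp [← map_pow, ← map_sub, hc]
    · simp [← pow_mul, mul_comm]

lemma constTerm_truncGeom_legendreLaurent (s : ℕ) :
    constTerm ℤ_[p][X] (truncGeom p (legendreLaurent (C (Ring.inverse (4 : ℤ_[p]) ^ 2) * X)) s) =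
      dworkT p s := by
  rw [truncGeom, map_sum, dworkT]
  refine sum_congr rfl fun n _ ↦ ?_
  rw [constTerm_legendreLaurent_pow, binomHalf, ← Ring.inverse_pow, mul_pow, mul_pow, mul_pow,
    ← pow_mul, mul_comm n 2, pow_mul (-1)]
  simp only [map_mul, map_pow, map_natCast]
  simp
  ring

lemma prime_natCast_padicInt_polynomial : Prime (p : ℤ_[p][X]) := by
  rw [← C_eq_natCast, prime_C_iff]
  exact PadicInt.prime_p

lemma not_dvd_expand_dworkT (s : ℕ) : ¬ (p : ℤ_[p][X]) ∣ expand ℤ_[p] p (dworkT p s) := by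
  have hp : p.Prime := Fact.out
  have h0 : (dworkT p s).coeff 0 = 1 := by
    rw [dworkT, finsetSum_coeff, sum_eq_single 0]
    · simp [binomHalf]
    · intro n _ hn
      simp [coeff_X_pow, hn.symm]
    · intro h; exact absurd (mem_range.2 (pow_pos hp.pos s)) h
  rw [← C_eq_natCast, C_dvd_iff_dvd_coeff]
  intro h
  have h1 := h 0
  rw [coeff_expand hp.pos, if_pos (dvd_zero p), Nat.zero_div, h0] at h1
  exact PadicInt.prime_p.not_isUnit (isUnit_of_dvd_one h1)

end PadicPolynomial

/-- **Dwork's congruence** for the Legendre family: for `p` an odd prime and `s ≥ 1`,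
`p^s` divides `T_{s+1}(z)·T_{s-1}(z^p) - T_s(z)·T_s(z^p)` in `ℤ_p[z]`. -/
theorem dwork_congruence_legendre (p : ℕ) [Fact p.Prime] (hp : p ≠ 2)
    (s : ℕ) (hs : 1 ≤ s) :
    ((p : Polynomial ℤ_[p])) ^ s ∣
      dworkT p (s + 1) * (dworkT p (s - 1)).comp (Polynomial.X ^ p) -
        dworkT p s * (dworkT p s).comp (Polynomial.X ^ p) := by
  have hprime : p.Prime := Fact.out
  obtain ⟨t, rfl⟩ := Nat.exists_eq_add_of_le' hs
  let φ : Polynomial ℤ_[p] →+* Polynomial ℤ_[p] := Polynomial.expand ℤ_[p] p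
  let L := legendreLaurent (Polynomial.C (Ring.inverse (4 : ℤ_[p]) ^ 2) * Polynomial.X)
  have hΦ := isFrobeniusLift_laurentFrobenius hprime (isFrobeniusLift_expand p)
  refine dvd_of_ghost_decomposition (prime_natCast_padicInt_polynomial p) φ (dworkT p)
    (fun k ↦ constTerm _ (ghostTerm p (laurentFrobenius p φ) L k))
    (fun k ↦ pow_dvd_constTerm (hΦ.pow_dvd_ghostTerm L k)) (fun r ↦ ?_)
    (not_dvd_expand_dworkT p) t
  rw [← constTerm_truncGeom_legendreLaurent, truncGeom_eq_sum_ghostTerm p (laurentFrobenius p φ),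
    map_sum]
  refine sum_congr rfl fun k _ ↦ ?_
  rw [constTerm_mul_laurentFrobenius hprime φ
    (ghostTerm_mem_laurentBox hprime φ (legendreLaurent_pow_mem _) k),
    constTerm_truncGeom_legendreLaurent]
end
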